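/- arXiv:2309.10648 — 6 statements merged into one kernel-verified Lean document; each statement's English description precedes it below -/
import Mathlib

section
/- Let p, q ≥ 2 be even integers, let G_{p,q} = ⟨x, y | x^p = y^q⟩, and let τ be the automorphism with τ(x) = x⁻¹, τ(y) = y⁻¹. Let w be x or y, let h ∈ G_{p,q}, let r ∈ ℤ be odd, and set g = h w^r τ(h)⁻¹. Then the fixed subgroup of ι_g ∘ τ is trivial: the only u ∈ G_{p,q} with (ι_g ∘ τ)(u) = u is u = 1. -/
/-- The torus knot group `⟨x, y | x^p = y^q⟩`, as the presented group obtained as the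
quotient of the free group on two generators by the normal closure of `a^p * b^(-q)`. -/
def TKG (p q : ℕ) : Type :=
  PresentedGroup ({FreeGroup.of true ^ p * (FreeGroup.of false ^ q)⁻¹} : Set (FreeGroup Bool))

instance TKG.instGroup (p q : ℕ) : Group (TKG p q) := by
  delta TKG; infer_instance

/-- The generator `x` of the torus knot group. -/
def TKx (p q : ℕ) : TKG p q := PresentedGroup.of true

/-- The generator `y` of the torus knot group. -/
def TKy (p q : ℕ) : TKG p q := PresentedGroup.of false

open Monoid

section FreeProduct

variable {M : Bool → Type} [∀ i, Group (M i)] [∀ i, DecidableEq (M i)]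

/-- The index of the first syllable of an element of a free product. -/
def TKfst (g : CoprodI M) : Option Bool := (CoprodI.Word.equiv g).fstIdx

theorem TKfst_prod (w : CoprodI.Word M) : TKfst w.prod = w.fstIdx := by
  exact congrArg CoprodI.Word.fstIdx (CoprodI.Word.equiv.apply_symm_apply w)

theorem TKexists_word (g : CoprodI M) : ∃ w : CoprodI.Word M, w.prod = g :=
  ⟨CoprodI.Word.equiv g, CoprodI.Word.equiv.symm_apply_apply g⟩

theorem TKfst_of_mul {i : Bool} (m : M i) (hm : m ≠ 1) (g : CoprodI M) (hg : TKfst g ≠ some i) :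
    TKfst (CoprodI.of m * g) = some i := by
  obtain ⟨w, rfl⟩ := TKexists_word g
  rw [TKfst_prod] at hg
  rw [← CoprodI.Word.prod_cons i m w hm hg, TKfst_prod, CoprodI.Word.fstIdx_cons]

theorem TKfst_one : TKfst (1 : CoprodI M) = none := by
  rw [← CoprodI.Word.prod_empty, TKfst_prod]; rfl

theorem TKfst_of {i : Bool} (m : M i) : TKfst (CoprodI.of m) = none ∨
    TKfst (CoprodI.of m) = some i := by
  by_cases hm : m = 1
  · left; rw [hm, map_one, TKfst_one]
  · right
    have := TKfst_of_mul m hm 1 (by rw [TKfst_one]; simp)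
    rwa [mul_one] at this

theorem TKfst_mul_of {i j : Bool} (hij : j ≠ i) (m : M i) (w : CoprodI.Word M) :
    TKfst (w.prod * CoprodI.of m) = some j ↔ w.fstIdx = some j := by
  induction w using CoprodI.Word.consRecOn with
  | empty =>
    rw [CoprodI.Word.prod_empty, one_mul]
    have : (CoprodI.Word.empty : CoprodI.Word M).fstIdx = none := rfl
    rw [this]
    rcases TKfst_of m with h | h <;> rw [h] <;> simp [hij.symm]
  | cons k n w h1 h2 ih =>
    rw [CoprodI.Word.prod_cons, CoprodI.Word.fstIdx_cons, mul_assoc]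
    by_cases hk : k = j
    · subst hk
      rw [TKfst_of_mul n h2 _ (fun h => h1 (ih.1 h))]
    · have hki : k = i := by revert hk hij; cases k <;> cases i <;> cases j <;> simp
      subst hki
      by_cases hw : w.fstIdx = some j
      · rw [TKfst_of_mul n h2 _ (by rw [ih.2 hw]; simpa using hij)]
      · have : w.fstIdx = none := by
          rcases hh : w.fstIdx with _ | l
          · rfl
          · rw [hh] at h1 hw
            revert h1 hw hij; cases l <;> cases k <;> cases j <;> simp
        have hwe : w = CoprodI.Word.empty := by
          apply CoprodI.Word.ext
          simpa [CoprodI.Word.fstIdx] using this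
        subst hwe
        rw [CoprodI.Word.prod_empty, one_mul, ← map_mul]
        rcases TKfst_of (n * m) with h | h <;> rw [h] <;> simp [hij.symm]

theorem TKfst_map (T : CoprodI M →* CoprodI M)
    (hT : ∀ i (m : M i), T (CoprodI.of m) = CoprodI.of m⁻¹) (w : CoprodI.Word M) :
    TKfst (T w.prod) = w.fstIdx := by
  induction w using CoprodI.Word.consRecOn with
  | empty => rw [CoprodI.Word.prod_empty, map_one, TKfst_one]; rfl
  | cons k n w h1 h2 ih =>
    rw [CoprodI.Word.prod_cons, CoprodI.Word.fstIdx_cons, map_mul, hT]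
    exact TKfst_of_mul _ (by simpa using h2) _ (by rwa [ih])

theorem TKfree (T : CoprodI M →* CoprodI M)
    (hT : ∀ i (m : M i), T (CoprodI.of m) = CoprodI.of m⁻¹) (i : Bool) (R : M i)
    (hR : ∀ a : M i, a * a ≠ R) (hc : ∀ a b : M i, a * b = b * a) (v : CoprodI M)
    (hv : v * CoprodI.of R = CoprodI.of R * T v) :
    ∃ a : M i, v = CoprodI.of a := by
  obtain ⟨w, rfl⟩ := TKexists_word v
  obtain ⟨P, rfl⟩ := (CoprodI.Word.equivPair i).symm.surjective w
  rw [CoprodI.Word.equivPair_symm, CoprodI.Word.prod_rcons] at *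
  obtain ⟨a, c, hP⟩ := P
  simp only at *
  rcases hh : c.fstIdx with _ | j
  · have hwe : c = CoprodI.Word.empty := by
      apply CoprodI.Word.ext
      simpa [CoprodI.Word.fstIdx] using hh
    exact ⟨a, by rw [hwe, CoprodI.Word.prod_empty, mul_one]⟩
  · exfalso
    have hji : j ≠ i := by rw [hh] at hP; simpa using hP
    rw [map_mul, hT] at hv
    have h1 : TKfst (c.prod * CoprodI.of R) = some j := (TKfst_mul_of hji R c).2 hh
    have h2 : TKfst (T c.prod) = some j := by rw [TKfst_map T hT, hh]
    have h3 : CoprodI.of (R⁻¹ * (a * a)) * (c.prod * CoprodI.of R) = T c.prod := by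
      have e : R⁻¹ * (a * a) = a * R⁻¹ * a := by rw [← mul_assoc, hc R⁻¹ a]
      rw [e, map_mul, mul_assoc, ← mul_assoc _ c.prod, hv, map_mul]
      simp
    have h4 : R⁻¹ * (a * a) ≠ 1 := fun h => hR a (by rwa [inv_mul_eq_one, eq_comm] at h)
    have h5 := TKfst_of_mul _ h4 (c.prod * CoprodI.of R) (by rw [h1]; simpa using hji)
    rw [h3, h2] at h5
    exact hji (by simpa using h5)

end FreeProduct

section Torus

variable (p q : ℕ)

/-- The two generators. -/
def TKgen (i : Bool) : TKG p q := PresentedGroup.of i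

/-- The two exponents. -/
def TKn (i : Bool) : ℕ := if i then p else q

theorem TKrel : TKgen p q true ^ p = TKgen p q false ^ q := by
  have h := PresentedGroup.one_of_mem
    (rels := ({FreeGroup.of true ^ p * (FreeGroup.of false ^ q)⁻¹} : Set (FreeGroup Bool)))
    (Set.mem_singleton _)
  rw [map_mul, map_inv, map_pow, map_pow, mul_inv_eq_one] at h
  exact h

theorem TKpow (i : Bool) : TKgen p q i ^ TKn p q i = TKgen p q true ^ p := by
  cases i
  · exact (TKrel p q).symm
  · rfl

theorem TKexists_hom {K : Type} [Group K] (f : Bool → K) (hf : f true ^ p = f false ^ q) :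
    ∃ F : TKG p q →* K, ∀ i, F (TKgen p q i) = f i := by
  have h : ∀ s ∈ ({FreeGroup.of true ^ p * (FreeGroup.of false ^ q)⁻¹} : Set (FreeGroup Bool)),
      FreeGroup.lift f s = 1 := by
    intro s hs
    rw [Set.mem_singleton_iff.1 hs]
    simp [hf]
  exact ⟨PresentedGroup.toGroup h, fun i => PresentedGroup.toGroup.of h⟩

theorem TKhom_ext {K : Type} [Group K] (F F' : TKG p q →* K)
    (h : ∀ i, F (TKgen p q i) = F' (TKgen p q i)) : F = F' :=
  PresentedGroup.ext h

theorem TKclosure (S : Subgroup (TKG p q)) (h : ∀ i, TKgen p q i ∈ S) : S = ⊤ := by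
  rw [eq_top_iff]
  have := PresentedGroup.closure_range_of
    ({FreeGroup.of true ^ p * (FreeGroup.of false ^ q)⁻¹} : Set (FreeGroup Bool))
  refine le_trans (le_of_eq this.symm) ((Subgroup.closure_le S).2 ?_)
  rintro _ ⟨i, rfl⟩
  exact h i

theorem TKcentral : TKgen p q true ^ p ∈ Subgroup.center (TKG p q) := by
  refine Subgroup.centralizer_eq_top_iff_subset.1 ?_ (Set.mem_singleton _)
  apply TKclosure
  intro i
  rw [Subgroup.mem_centralizer_singleton_iff, ← TKpow p q i]
  exact (Commute.refl _).pow_right _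

instance TKnormal : (Subgroup.zpowers (TKgen p q true ^ p)).Normal :=
  ⟨fun n hn g => by
    have hc := Subgroup.mem_center_iff.1 (Subgroup.zpowers_le.2 (TKcentral p q) hn) g
    rwa [hc, mul_inv_cancel_right]⟩

/-- The cyclic factors of the central quotient. -/
abbrev TKfac (i : Bool) : Type := Multiplicative (ZMod (TKn p q i))

theorem TKexists_proj : ∃ F : TKG p q →* CoprodI (TKfac p q),
    (∀ i, F (TKgen p q i) = CoprodI.of (M := TKfac p q) (i := i) (Multiplicative.ofAdd 1)) ∧
    ∀ v, F v = 1 → v ∈ Subgroup.zpowers (TKgen p q true ^ p) := by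
  have key : ∀ i, (CoprodI.of (M := TKfac p q) (i := i) (Multiplicative.ofAdd 1)) ^ TKn p q i = 1 := by
    intro i
    rw [← map_pow, ← ofAdd_nsmul, nsmul_one, ZMod.natCast_self, ofAdd_zero, map_one]
  obtain ⟨F, hF⟩ := TKexists_hom p q
    (fun i => CoprodI.of (M := TKfac p q) (i := i) (Multiplicative.ofAdd 1))
    ((key true).trans (key false).symm)
  refine ⟨F, hF, fun v hv => ?_⟩
  have hl : ∀ i, ∃ f : TKfac p q i →* (TKG p q ⧸ Subgroup.zpowers (TKgen p q true ^ p)),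
      f (Multiplicative.ofAdd 1) = QuotientGroup.mk (TKgen p q i) := by
    intro i
    let z : ℤ →+ Additive (TKG p q ⧸ Subgroup.zpowers (TKgen p q true ^ p)) :=
      zmultiplesHom _ (Additive.ofMul (QuotientGroup.mk (TKgen p q i)))
    have hz : z (TKn p q i) = 0 := by
      simp only [z, zmultiplesHom_apply, natCast_zsmul]
      rw [← ofMul_pow, ← QuotientGroup.mk_pow, TKpow, ofMul_eq_zero, QuotientGroup.eq_one_iff]
      exact Subgroup.mem_zpowers _
    refine ⟨AddMonoidHom.toMultiplicativeLeft (ZMod.lift _ ⟨z, hz⟩), ?_⟩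
    have := ZMod.lift_coe (TKn p q i) ⟨z, hz⟩ 1
    rw [Int.cast_one] at this
    simp only [AddMonoidHom.toMultiplicativeLeft_apply_apply, toAdd_ofAdd]
    rw [this]
    simp [z]
  choose f hf using hl
  have e : (CoprodI.lift f).comp F = QuotientGroup.mk' (Subgroup.zpowers (TKgen p q true ^ p)) := by
    apply TKhom_ext
    intro i
    rw [MonoidHom.comp_apply, hF, CoprodI.lift_of, hf]
    rfl
  have := DFunLike.congr_fun e v
  rw [MonoidHom.comp_apply, hv, map_one] at this
  exact (QuotientGroup.eq_one_iff v).1 this.symm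

theorem TKtorsion (hp : 2 ≤ p) (hq : 2 ≤ q) (i : Bool) (a : ℤ) (h : TKgen p q i ^ a = 1) :
    a = 0 := by
  obtain ⟨F, hF⟩ := TKexists_hom p q
    (fun i => Multiplicative.ofAdd (if i then (q : ℤ) else p))
    (by rw [← ofAdd_nsmul, ← ofAdd_nsmul]; simp [mul_comm])
  have h1 := congrArg F h
  rw [map_zpow, hF, map_one, ← ofAdd_zsmul, ofAdd_eq_one, smul_eq_mul, mul_eq_zero] at h1
  rcases h1 with h1 | h1
  · exact h1
  · exfalso; revert h1; cases i <;> simp <;> omega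

theorem TKmain (hp : 2 ≤ p) (hq : 2 ≤ q) (hpe : Even p) (hqe : Even q)
    (τ : MulAut (TKG p q)) (hτ : ∀ i, τ (TKgen p q i) = (TKgen p q i)⁻¹)
    (i : Bool) (r : ℤ) (hr : Odd r) (v : TKG p q)
    (hv : v * TKgen p q i ^ r = TKgen p q i ^ r * τ v) : v = 1 := by
  have hev : ∀ i, Even (TKn p q i) := by intro i; cases i <;> simpa [TKn]
  obtain ⟨F, hF, hker⟩ := TKexists_proj p q
  let T : CoprodI (TKfac p q) →* CoprodI (TKfac p q) :=
    CoprodI.lift (fun i => (CoprodI.of (M := TKfac p q) (i := i)).comp (invMonoidHom))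
  have hT : ∀ i (m : TKfac p q i), T (CoprodI.of m) = CoprodI.of m⁻¹ := by
    intro i m
    simp only [T, CoprodI.lift_of]
    rfl
  have hTF : ∀ u, F (τ u) = T (F u) := by
    have : F.comp τ.toMonoidHom = T.comp F := by
      apply TKhom_ext
      intro j
      simp only [MonoidHom.comp_apply, hF, hT]
      rw [map_inv, ← hF, ← map_inv, ← hτ]
      rfl
    exact fun u => DFunLike.congr_fun this u
  have hpw : ∀ j (a : ℤ), F (TKgen p q j ^ a) =
      CoprodI.of (M := TKfac p q) (i := j) (Multiplicative.ofAdd (a : ZMod (TKn p q j))) := by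
    intro j a
    rw [map_zpow, hF, ← map_zpow, ← ofAdd_zsmul, zsmul_one]
  obtain ⟨b, hb⟩ : ∃ b : TKfac p q i, F v = CoprodI.of b := by
    classical
    refine TKfree T hT i (Multiplicative.ofAdd (r : ZMod (TKn p q i))) ?_ (fun a b => mul_comm a b)
      (F v) ?_
    · intro a ha
      have h2 : 2 ∣ TKn p q i := (hev i).two_dvd
      have ha' := congrArg (fun t => ZMod.castHom h2 (ZMod 2) (Multiplicative.toAdd t)) ha
      simp only [toAdd_mul, toAdd_ofAdd, map_add, map_intCast, CharTwo.add_self_eq_zero] at ha'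
      have := (ZMod.intCast_zmod_eq_zero_iff_dvd r 2).1 ha'.symm
      rcases hr with ⟨k, hk⟩
      push_cast at this
      omega
    · rw [← hpw, ← hTF, ← map_mul, ← map_mul, hv]
  obtain ⟨a, ha⟩ := ZMod.intCast_surjective (Multiplicative.toAdd b)
  have hb' : F v = F (TKgen p q i ^ a) := by rw [hpw, ha, hb]; rfl
  have hm := hker ((TKgen p q i ^ a)⁻¹ * v) (by rw [map_mul, map_inv, hb', inv_mul_cancel])
  obtain ⟨k, hk⟩ := Subgroup.mem_zpowers_iff.1 hm
  obtain ⟨c, hc⟩ : ∃ c : ℤ, v = TKgen p q i ^ c := by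
    refine ⟨a + TKn p q i * k, ?_⟩
    rw [zpow_add, zpow_mul, zpow_natCast, TKpow, hk, mul_inv_cancel_left]
  rw [hc, map_zpow, hτ, ← zpow_add, inv_zpow', ← zpow_add, ← mul_inv_eq_one, ← zpow_neg,
    ← zpow_add] at hv
  have := TKtorsion p q hp hq i _ hv
  have c0 : c = 0 := by omega
  rw [hc, c0, zpow_zero]

end Torus

/-- Let `p, q ≥ 2` be even, let `w ∈ {x, y}`, let `r` be odd and `g = h w^r τ(h)⁻¹`.
Then the fixed subgroup of `ι_g ∘ τ` is trivial. -/
theorem TKG_fix_tau_g_odd_r_trivial (p q : ℕ) (hp : 2 ≤ p) (hq : 2 ≤ q)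
    (hpe : Even p) (hqe : Even q)
    (τ : MulAut (TKG p q))
    (hτx : τ (TKx p q) = (TKx p q)⁻¹) (hτy : τ (TKy p q) = (TKy p q)⁻¹)
    (w : TKG p q) (hw : w = TKx p q ∨ w = TKy p q)
    (h : TKG p q) (r : ℤ) (hr : Odd r)
    (g : TKG p q) (hg : g = h * w ^ r * (τ h)⁻¹) :
    ∀ u : TKG p q, (MulAut.conj g * τ) u = u → u = 1 := by
  intro u hu
  have hτ : ∀ i, τ (TKgen p q i) = (TKgen p q i)⁻¹ := by
    intro i
    cases i
    · exact hτy
    · exact hτx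
  obtain ⟨i, hi⟩ : ∃ i, w = TKgen p q i := by
    rcases hw with hw | hw
    · exact ⟨true, hw⟩
    · exact ⟨false, hw⟩
  rw [MulAut.mul_apply, MulAut.conj_apply, hg] at hu
  have hv : h⁻¹ * u * h = 1 := by
    apply TKmain p q hp hq hpe hqe τ hτ i r hr
    rw [← hi]
    nth_rewrite 1 [← hu]
    rw [map_mul, map_mul, map_inv]
    group
  have : u = h * (h⁻¹ * u * h) * h⁻¹ := by group
  rw [this, hv]
  group
end

section
/- Let p ≥ 2 and G_{p,p} = ⟨x, y | x^p = y^p⟩. Let ψ be an automorphism of G_{p,p} satisfying either (ψ(x) = y and ψ(y) = x) or (ψ(x) = y⁻¹ and ψ(y) = x⁻¹) (i.e. ψ = σ or ψ = σ∘τ). For g ∈ G_{p,p}, the following are equivalent: (1) g·ψ(g) ∈ Z(G_{p,p}); (2) (ι_g ∘ ψ)² = id; (3) ι_g ∘ ψ has finite order in Aut(G_{p,p}). -/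
open Monoid in
/-- positive powers of a cyclically reduced word are reduced words -/
lemma TKaux_pow {ι : Type*} {M : ι → Type*} [∀ i, Group (M i)] {i j : ι} (hij : i ≠ j)
    (w : CoprodI.NeWord M i j) (n : ℕ) :
    ∃ v : CoprodI.NeWord M i j, v.prod = w.prod ^ (n + 1) := by
  induction n with
  | zero => exact ⟨w, by simp⟩
  | succ n ih =>
    obtain ⟨v, hv⟩ := ih
    exact ⟨v.append hij.symm w, by rw [CoprodI.NeWord.append_prod, hv, ← pow_succ]⟩

open Monoid in
lemma TKaux_not_central {ι : Type*} {M : ι → Type*} [∀ i, Group (M i)] {i j : ι} (hij : i ≠ j)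
    (v : CoprodI.NeWord M i j) (hv : v.prod ∈ Subgroup.center (CoprodI M)) : False := by
  classical
  have hne : v.head ≠ 1 := by
    have h1 := v.toList_head?
    exact v.toWord.ne_one ⟨i, v.head⟩ (List.mem_of_head? h1)
  let s : CoprodI.NeWord M i i := .singleton v.head hne
  let t : CoprodI.NeWord M i i := (v.append hij.symm s).append hij v.inv
  have h : t.prod = s.prod := by
    simp only [t, CoprodI.NeWord.append_prod, CoprodI.NeWord.inv_prod]
    rw [← Subgroup.mem_center_iff.1 hv s.prod, mul_inv_cancel_right]
  have h2 : t.toWord = s.toWord := CoprodI.Word.equiv.symm.injective h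
  have h3 : t.toList.length = s.toList.length := congrArg (fun w => w.toList.length) h2
  have h4 := List.length_pos_of_ne_nil v.toList_ne_nil
  have h5 : t.toList.length = v.toList.length + 1 + v.inv.toList.length := by
    simp [t, s]; omega
  have h6 : s.toList.length = 1 := by simp [s]
  omega

open Monoid in
lemma TKaux_conj {ι : Type*} [Nonempty ι] {M : ι → Type*} [∀ i, Group (M i)] (n : ℕ) :
    ∀ (k : ℕ) (w : CoprodI.Word M), w.toList.length = k →
      w.prod ^ (n + 1) ∈ Subgroup.center (CoprodI M) →
      ∃ (i : ι) (a : M i) (u : CoprodI M), w.prod = u * CoprodI.of a * u⁻¹ := by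
  classical
  intro k
  induction k using Nat.strong_induction_on with
  | _ k ih =>
  intro w hk hc
  -- the conjugation step
  have key : ∀ (u : CoprodI M) (w' : CoprodI.Word M), w'.toList.length < k →
      w.prod = u * w'.prod * u⁻¹ →
      ∃ (i : ι) (a : M i) (u : CoprodI M), w.prod = u * CoprodI.of a * u⁻¹ := by
    intro u w' hl he
    have hc' : w'.prod ^ (n + 1) ∈ Subgroup.center (CoprodI M) := by
      have : w'.prod = u⁻¹ * w.prod * u := by rw [he]; group
      rw [this]
      have h2 := conj_pow (a := u⁻¹) (b := w.prod) (i := n + 1)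
      rw [inv_inv] at h2
      rw [h2, Subgroup.mem_center_iff.1 hc, mul_assoc, inv_mul_cancel, mul_one]
      exact hc
    obtain ⟨i, a, v, h⟩ := ih _ hl w' rfl hc'
    exact ⟨i, a, u * v, by rw [he, h]; group⟩
  by_cases hw : w = CoprodI.Word.empty
  · subst hw
    exact ⟨Classical.arbitrary ι, 1, 1, by simp⟩
  obtain ⟨i, j, w', hw'⟩ := CoprodI.NeWord.of_word w hw
  by_cases hij : i = j
  · have hh := w'.toList_head?
    have hl := w'.toList_getLast?
    have hL : w'.toList = w.toList := congrArg CoprodI.Word.toList hw'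
    rw [hL] at hh hl
    subst hij
    obtain ⟨l, hne, hch⟩ := w
    simp only at hh hl hk
    rcases l with _ | ⟨x, l⟩
    · simp at hh
    rcases List.eq_nil_or_concat l with rfl | ⟨m, y, hm0⟩
    · exact ⟨x.1, x.2, 1, by simp [CoprodI.Word.prod]⟩
    rw [List.concat_eq_append] at hm0
    subst hm0
    have hx : x = ⟨i, w'.head⟩ := by simpa using hh
    have hy : y = ⟨i, w'.last⟩ := by
      rw [← List.cons_append, List.getLast?_concat] at hl
      simpa using hl
    generalize w'.head = a at hx
    generalize w'.last = b at hy
    subst hx hy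
    have hch2 : (m ++ [⟨i, b⟩] : List (Σ i, M i)).IsChain fun l l' => l.1 ≠ l'.1 := hch.tail
    rw [List.isChain_append] at hch2
    have hm : ∀ l ∈ m, Sigma.snd l ≠ 1 := fun l hl => hne l (by simp [hl])
    by_cases hab : b * a = 1
    · refine key (CoprodI.of a) ⟨m, hm, hch2.1⟩ (by simp at hk ⊢; omega) ?_
      have : (CoprodI.of a : CoprodI M)⁻¹ = CoprodI.of b := by
        rw [← map_inv]; congr 1; exact (eq_inv_of_mul_eq_one_left hab).symm
      simp [CoprodI.Word.prod, this, mul_assoc]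
    · refine key (CoprodI.of a) ⟨m ++ [⟨i, b * a⟩], ?_, ?_⟩ (by simp at hk ⊢; omega) ?_
      · intro l hl
        rcases List.mem_append.1 hl with h | h
        · exact hm l h
        · rw [List.mem_singleton] at h
          subst h; exact hab
      · rw [List.isChain_append]
        refine ⟨hch2.1, List.isChain_singleton _, ?_⟩
        intro s hs t ht
        have := hch2.2.2 s hs ⟨i, b⟩ (by simp)
        simp at ht
        subst ht; exact this
      · simp [CoprodI.Word.prod, mul_assoc]
  · exfalso
    obtain ⟨v, hv⟩ := TKaux_pow hij w' n
    refine TKaux_not_central hij v ?_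
    rw [hv]
    have : w'.prod = w.prod := congrArg CoprodI.Word.prod hw'
    rw [this]; exact hc

open Monoid in
lemma TKaux_conj' {ι : Type*} [Nonempty ι] {M : ι → Type*} [∀ i, Group (M i)] (n : ℕ)
    (h : CoprodI M) (hc : h ^ (n + 1) ∈ Subgroup.center (CoprodI M)) :
    ∃ (i : ι) (a : M i) (u : CoprodI M), h = u * CoprodI.of a * u⁻¹ := by
  classical
  have e : (CoprodI.Word.equiv h).prod = h := CoprodI.Word.equiv.symm_apply_apply h
  obtain ⟨i, a, u, hu⟩ := TKaux_conj n _ (CoprodI.Word.equiv h) rfl (by rwa [e])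
  exact ⟨i, a, u, by rw [← hu, e]⟩

lemma TKG_hom_ext {p : ℕ} {N : Type*} [Group N] {f g : TKG p p →* N}
    (hx : f (TKx p p) = g (TKx p p)) (hy : f (TKy p p) = g (TKy p p)) : f = g := by
  apply PresentedGroup.ext
  rintro (_ | _)
  · exact hy
  · exact hx

lemma TKG_rel (p : ℕ) : TKx p p ^ p = TKy p p ^ p := by
  have : (PresentedGroup.mk ({FreeGroup.of true ^ p * (FreeGroup.of false ^ p)⁻¹} :
      Set (FreeGroup Bool))) (FreeGroup.of true ^ p * (FreeGroup.of false ^ p)⁻¹) = 1 :=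
    PresentedGroup.one_of_mem rfl
  rw [map_mul, map_inv, map_pow, map_pow, mul_inv_eq_one] at this
  exact this

lemma TKG_top {p : ℕ} (H : Subgroup (TKG p p)) (hx : TKx p p ∈ H) (hy : TKy p p ∈ H)
    (g : TKG p p) : g ∈ H := by
  refine PresentedGroup.generated_by _ H ?_ g
  rintro (_ | _)
  · exact hy
  · exact hx

lemma TKG_xp_central (p : ℕ) : TKx p p ^ p ∈ Subgroup.center (TKG p p) := by
  rw [Subgroup.mem_center_iff]
  intro g
  have := TKG_top (Subgroup.centralizer {TKx p p ^ p}) (p := p)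
    (Subgroup.mem_centralizer_singleton_iff.2 ((Commute.refl _).pow_right p).eq)
    (Subgroup.mem_centralizer_singleton_iff.2 (by
      rw [TKG_rel]; exact ((Commute.refl _).pow_right p).eq)) g
  exact Subgroup.mem_centralizer_singleton_iff.1 this

abbrev TKM (p : ℕ) : Bool → Type := fun _ => Multiplicative (ZMod p)

/-- projection to the free product of two cyclic groups -/
def TKproj (p : ℕ) : TKG p p →* Monoid.CoprodI (TKM p) :=
  PresentedGroup.toGroup
    (f := fun b : Bool => (Monoid.CoprodI.of (M := TKM p) (i := b)
      (Multiplicative.ofAdd (1 : ZMod p)))) (by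
    rintro r rfl
    have h : (Multiplicative.ofAdd (1 : ZMod p)) ^ p = 1 := by
      rw [← ofAdd_nsmul]; simp
    simp only [map_mul, map_pow, map_inv, FreeGroup.lift_apply_of]
    have h' : ∀ b : Bool, (Monoid.CoprodI.of (M := TKM p) (i := b)
        (Multiplicative.ofAdd (1 : ZMod p))) ^ p = 1 := fun b =>
      (map_pow (Monoid.CoprodI.of (M := TKM p) (i := b)) _ _).symm.trans
        ((congrArg _ h).trans (map_one _))
    rw [h', h']; simp)

lemma TKproj_x (p : ℕ) : TKproj p (TKx p p) =
    Monoid.CoprodI.of (M := TKM p) (i := true) (Multiplicative.ofAdd (1 : ZMod p)) :=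
  PresentedGroup.toGroup.of _

lemma TKproj_y (p : ℕ) : TKproj p (TKy p p) =
    Monoid.CoprodI.of (M := TKM p) (i := false) (Multiplicative.ofAdd (1 : ZMod p)) :=
  PresentedGroup.toGroup.of _

lemma TKproj_surj (p : ℕ) : Function.Surjective (TKproj p) := by
  intro c
  change c ∈ (TKproj p).range
  induction c using Monoid.CoprodI.induction_on with
  | one => exact one_mem _
  | of i m =>
    obtain ⟨k, hk⟩ := ZMod.intCast_surjective (Multiplicative.toAdd m)
    have hm : m = (Multiplicative.ofAdd (1 : ZMod p)) ^ k := by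
      rw [← ofAdd_zsmul]; simp [hk]
    rw [hm, map_zpow]
    apply zpow_mem
    cases i
    · exact ⟨_, TKproj_y p⟩
    · exact ⟨_, TKproj_x p⟩
  | mul a b ha hb => exact mul_mem ha hb

/-- The hom from `Z/p` determined by an element killed by `p`. -/
noncomputable def TKcyc {p : ℕ} {N : Type*} [Group N] (a : N) (ha : a ^ p = 1) :
    Multiplicative (ZMod p) →* N :=
  AddMonoidHom.toMultiplicativeLeft
    (ZMod.lift p (A := Additive N) ⟨(zmultiplesHom (Additive N)) (Additive.ofMul a), by
      simp [← ofMul_pow, ha]⟩)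

lemma TKcyc_one {p : ℕ} {N : Type*} [Group N] (a : N) (ha : a ^ p = 1) :
    TKcyc a ha (Multiplicative.ofAdd (1 : ZMod p)) = a := by
  have := ZMod.lift_coe p (A := Additive N) ⟨(zmultiplesHom (Additive N)) (Additive.ofMul a), by
      simp [← ofMul_pow, ha]⟩ 1
  simp only [Int.cast_one, zmultiplesHom_apply, one_smul] at this
  exact congrArg Additive.toMul this

lemma TKproj_ker {p : ℕ} (h : TKG p p) (hh : TKproj p h = 1) :
    h ∈ Subgroup.center (TKG p p) := by
  let q := QuotientGroup.mk' (Subgroup.center (TKG p p))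
  have hx : q (TKx p p) ^ p = 1 := by
    rw [← map_pow]; exact (QuotientGroup.eq_one_iff _).2 (TKG_xp_central p)
  have hy : q (TKy p p) ^ p = 1 := by
    rw [← map_pow, ← TKG_rel]; exact (QuotientGroup.eq_one_iff _).2 (TKG_xp_central p)
  let r : Monoid.CoprodI (TKM p) →* (TKG p p ⧸ Subgroup.center (TKG p p)) :=
    Monoid.CoprodI.lift (fun b => match b with
      | true => TKcyc _ hx
      | false => TKcyc _ hy)
  have : r.comp (TKproj p) = q := by
    apply TKG_hom_ext
    · simp only [MonoidHom.comp_apply, TKproj_x, r, Monoid.CoprodI.lift_of, TKcyc_one]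
    · simp only [MonoidHom.comp_apply, TKproj_y, r, Monoid.CoprodI.lift_of, TKcyc_one]
  have h1 : q h = 1 := by rw [← this, MonoidHom.comp_apply, hh, map_one]
  exact (QuotientGroup.eq_one_iff _).1 h1

/-- coordinate of the abelianisation of the free product -/
def TKab (p : ℕ) (i : Bool) : Monoid.CoprodI (TKM p) →* Multiplicative (ZMod p) :=
  Monoid.CoprodI.lift (fun b => if b = i then MonoidHom.id _ else 1)

lemma TKab_of (p : ℕ) (i j : Bool) (a : Multiplicative (ZMod p)) :
    TKab p i (Monoid.CoprodI.of (M := TKM p) (i := j) a) = if j = i then a else 1 := by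
  unfold TKab
  rw [Monoid.CoprodI.lift_of]
  split_ifs <;> rfl

/-- if `h` has a central power and its two coordinates are trivial together, `h` is central -/
lemma TK_central {p : ℕ} (n : ℕ) (h : TKG p p) (hn : h ^ (n + 1) ∈ Subgroup.center (TKG p p))
    (hab : TKab p true (TKproj p h) = 1 ↔ TKab p false (TKproj p h) = 1) :
    h ∈ Subgroup.center (TKG p p) := by
  apply TKproj_ker
  obtain ⟨i, a, u, hu⟩ := TKaux_conj' n (TKproj p h) (by
    rw [Subgroup.mem_center_iff]
    intro c
    obtain ⟨c, rfl⟩ := TKproj_surj p c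
    rw [← map_pow, ← map_mul, ← map_mul, Subgroup.mem_center_iff.1 hn])
  have ha : a = 1 := by
    rw [hu] at hab
    cases i <;> simpa [TKab_of] using hab
  rw [hu, ha]; simp

/-- For `ψ ∈ {σ, σ∘τ}` (i.e. `ψ : x ↦ y, y ↦ x` or `ψ : x ↦ y⁻¹, y ↦ x⁻¹`) and
`g ∈ G_{p,p}`, the following are equivalent: `g·ψ(g)` is central; `(ι_g ∘ ψ)² = id`;
`ι_g ∘ ψ` has finite order. -/
theorem TKG_sigma_finite_order_characterisation (p : ℕ) (hp : 2 ≤ p)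
    (ψ : MulAut (TKG p p))
    (hψ : (ψ (TKx p p) = TKy p p ∧ ψ (TKy p p) = TKx p p) ∨
          (ψ (TKx p p) = (TKy p p)⁻¹ ∧ ψ (TKy p p) = (TKx p p)⁻¹))
    (g : TKG p p) :
    (g * ψ g ∈ Subgroup.center (TKG p p) ↔ (MulAut.conj g * ψ) ^ 2 = 1) ∧
    ((MulAut.conj g * ψ) ^ 2 = 1 ↔ IsOfFinOrder (MulAut.conj g * ψ)) := by
  have hψ2 : ∀ a, ψ (ψ a) = a := by
    have : (ψ.toMonoidHom.comp ψ.toMonoidHom) = MonoidHom.id _ := by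
      rcases hψ with ⟨h1, h2⟩ | ⟨h1, h2⟩ <;> apply TKG_hom_ext <;> simp [h1, h2]
    intro a
    exact DFunLike.congr_fun this a
  have hsq : (MulAut.conj g * ψ) ^ 2 = MulAut.conj (g * ψ g) := by
    ext a
    simp [pow_two, hψ2, mul_assoc]
  have hconj : ∀ a : TKG p p, MulAut.conj a = 1 ↔ a ∈ Subgroup.center (TKG p p) := by
    intro a
    rw [Subgroup.mem_center_iff]
    constructor
    · intro h b
      have : a * b * a⁻¹ = b := DFunLike.congr_fun h b
      exact (mul_inv_eq_iff_eq_mul.1 this).symm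
    · intro h
      ext b
      change a * b * a⁻¹ = b
      rw [mul_inv_eq_iff_eq_mul]; exact (h b).symm
  refine ⟨by rw [hsq, hconj], ?_, ?_⟩
  · intro h
    exact isOfFinOrder_iff_pow_eq_one.2 ⟨2, by norm_num, h⟩
  · intro h
    obtain ⟨n, hn, h1⟩ := isOfFinOrder_iff_pow_eq_one.1 h
    obtain ⟨n, rfl⟩ : ∃ m, n = m + 1 := ⟨n - 1, by omega⟩
    have h2 : (g * ψ g) ^ (n + 1) ∈ Subgroup.center (TKG p p) := by
      rw [← hconj, map_pow, ← hsq, ← pow_mul, mul_comm, pow_mul, h1, one_pow]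
    rw [hsq, hconj]
    refine TK_central n _ h2 ?_
    rcases hψ with ⟨hx, hy⟩ | ⟨hx, hy⟩
    · have e : ((TKab p true).comp (TKproj p)).comp ψ.toMonoidHom
          = (TKab p false).comp (TKproj p) := by
        apply TKG_hom_ext <;> simp [hx, hy, TKproj_x, TKproj_y, TKab_of]
      have e' : ((TKab p false).comp (TKproj p)).comp ψ.toMonoidHom
          = (TKab p true).comp (TKproj p) := by
        apply TKG_hom_ext <;> simp [hx, hy, TKproj_x, TKproj_y, TKab_of]
      have k : TKab p true (TKproj p (ψ g)) = TKab p false (TKproj p g) :=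
        DFunLike.congr_fun e g
      have k' : TKab p false (TKproj p (ψ g)) = TKab p true (TKproj p g) :=
        DFunLike.congr_fun e' g
      simp only [map_mul, k, k']
      rw [mul_comm]
    · have e : ((TKab p true).comp (TKproj p)).comp ψ.toMonoidHom
          = ((TKab p false).comp (TKproj p))⁻¹ := by
        apply TKG_hom_ext <;> simp [hx, hy, TKproj_x, TKproj_y, TKab_of]
      have e' : ((TKab p false).comp (TKproj p)).comp ψ.toMonoidHom
          = ((TKab p true).comp (TKproj p))⁻¹ := by
        apply TKG_hom_ext <;> simp [hx, hy, TKproj_x, TKproj_y, TKab_of]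
      have k : TKab p true (TKproj p (ψ g)) = (TKab p false (TKproj p g))⁻¹ :=
        DFunLike.congr_fun e g
      have k' : TKab p false (TKproj p (ψ g)) = (TKab p true (TKproj p g))⁻¹ :=
        DFunLike.congr_fun e' g
      simp only [map_mul, k, k', mul_inv_eq_one]
      exact eq_comm
end

section
/- Let p ≥ 2 and G_{p,p} = ⟨x, y | x^p = y^p⟩, and let σ be the automorphism with σ(x) = y, σ(y) = x. Suppose ι_g ∘ σ has infinite order in Aut(G_{p,p}) (equivalently g·σ(g) ∉ Z(G_{p,p})). Then the fixed subgroup Fix(ι_g ∘ σ) equals the centralizer C(g·σ(g)) of g·σ(g), and this subgroup is isomorphic to ℤ × ℤ; moreover it contains the central element x^p. -/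
/-- The fixed subgroup `Fix(φ) = {h : φ h = h}` of an automorphism `φ`. -/
def fixSubgroup {G : Type*} [Group G] (φ : G ≃* G) : Subgroup G where
  carrier := {h | φ h = h}
  one_mem' := map_one φ
  mul_mem' := fun ha hb => by
    simp only [Set.mem_setOf_eq] at *
    rw [map_mul, ha, hb]
  inv_mem' := fun ha => by
    simp only [Set.mem_setOf_eq] at *
    rw [map_inv, ha]

namespace TKGaux
lemma center_free {S : Type*} (i j : S) (hij : i ≠ j) (w : FreeGroup S)
    (hc : ∀ v, v * w = w * v) : w = 1 := by
  classical
  by_contra hw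
  have hL : w.toWord ≠ [] := by simpa using hw
  have hred : FreeGroup.IsReduced w.toWord := FreeGroup.isReduced_toWord
  have hmk : FreeGroup.mk w.toWord = w := FreeGroup.mk_toWord
  generalize w.toWord = L at *
  obtain ⟨k, hk⟩ : ∃ k, k ≠ (L.head hL).1 := by
    by_cases h : i = (L.head hL).1
    · exact ⟨j, fun h' => hij (h.trans h'.symm)⟩
    · exact ⟨i, h⟩
  set c : S × Bool := (k, (L.getLast hL).2) with hcdef
  have h1 : FreeGroup.IsReduced (c :: L) := by
    cases L with
    | nil => exact absurd rfl hL
    | cons l L =>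
      refine List.isChain_cons_cons.2 ⟨fun h => absurd h hk, hred⟩
  have h2 : FreeGroup.IsReduced (L ++ [c]) := by
    refine List.isChain_append.2 ⟨hred, List.isChain_singleton _, ?_⟩
    intro x hx y hy h
    rw [List.getLast?_eq_getLast_of_ne_nil hL] at hx
    simp at hx hy
    subst hx hy
    rfl
  have h3 := hc (FreeGroup.mk [c])
  rw [← hmk, FreeGroup.mul_mk, FreeGroup.mul_mk] at h3
  have h4 := FreeGroup.reduce.sound h3
  rw [show [c] ++ L = c :: L from rfl, h1.reduce_eq, h2.reduce_eq] at h4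
  have h5 : (c :: L).head? = (L ++ [c]).head? := by rw [h4]
  rw [List.head?_append_of_ne_nil _ hL, List.head?_eq_some_head hL] at h5
  simp at h5
  exact hk (by rw [← h5])

lemma free_centralizer {K : Type} [Group K] [IsFreeGroup K] (f : K) (hf : f ≠ 1) :
    ∃ a : K, ∀ h : K, h * f = f * h ↔ h ∈ Subgroup.zpowers a := by
  let H := Subgroup.centralizer {f}
  have hH : ∀ h : K, h ∈ H ↔ h * f = f * h := fun h => by
    simp only [H, Subgroup.mem_centralizer_singleton_iff]
    
  let e := IsFreeGroup.toFreeGroup H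
  have hfH : f ∈ H := (hH f).2 rfl
  have hsub : Subsingleton (IsFreeGroup.Generators H) := by
    constructor
    intro i j
    by_contra hij
    have h0 := center_free i j hij (e ⟨f, hfH⟩) (by
      intro v
      obtain ⟨h, rfl⟩ := e.surjective v
      rw [← map_mul, ← map_mul]
      congr 1
      exact Subtype.ext ((hH _).1 h.2))
    rw [EmbeddingLike.map_eq_one_iff] at h0
    exact hf (congrArg Subtype.val h0)
  have hcyc : ∃ b : FreeGroup (IsFreeGroup.Generators H), ∀ v, v ∈ Subgroup.zpowers b := by
    rcases isEmpty_or_nonempty (IsFreeGroup.Generators H) with h | ⟨⟨s⟩⟩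
    · exact ⟨1, fun v => by rw [Subsingleton.elim v 1]; exact one_mem _⟩
    · refine ⟨FreeGroup.of s, fun v => ?_⟩
      induction v using FreeGroup.induction_on with
      | C1 => exact one_mem _
      | of t => rw [Subsingleton.elim t s]; exact Subgroup.mem_zpowers _
      | inv_of t ih => exact inv_mem ih
      | mul x y hx hy => exact mul_mem hx hy
  obtain ⟨b, hb⟩ := hcyc
  refine ⟨(e.symm b : H), fun h => ⟨fun hh => ?_, ?_⟩⟩
  · obtain ⟨n, hn⟩ := hb (e ⟨h, (hH h).2 hh⟩)
    refine ⟨n, ?_⟩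
    have : (e.symm b) ^ n = ⟨h, (hH h).2 hh⟩ := by
      rw [← map_zpow]; simp only at hn; rw [hn, MulEquiv.symm_apply_apply]
    have := congrArg Subtype.val this
    simpa using this
  · intro hh
    rw [← hH]
    exact (Subgroup.zpowers_le.2 (e.symm b).2) hh

lemma free_tf {K : Type} [Group K] [IsFreeGroup K] (k : K) (n : ℤ) (hn : n ≠ 0) (h : k ^ n = 1) :
    k = 1 := by
  have := zpow_left_injective hn (a₁ := IsFreeGroup.toFreeGroup K k) (a₂ := 1) (by
    simp [← map_zpow, h])
  simpa using this
end TKGaux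
namespace TKGaux
section abstractPart
variable {G : Type} [Group G]

lemma mem_or (ε : G →* Multiplicative ℤ) (z h : G) :
    ε (h ^ (Multiplicative.toAdd (ε z)) * (z ^ (Multiplicative.toAdd (ε h)))⁻¹) = 1 := by
  apply Multiplicative.toAdd.injective
  simp [mul_comm]

lemma comm_of_eq_one {a b c : G} (h : a * b * a⁻¹ * b⁻¹ = c) : a * b * a⁻¹ = c * b := by
  rw [← h]; group

theorem abs_main (ε : G →* Multiplicative ℤ) [IsFreeGroup ε.ker]
    (z u : G) (hz : ∀ h, z * h = h * z) (hεz : ε z ≠ 1)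
    (φ : MulAut G) (hφz : φ z = z) (hφε : ∀ h, ε (φ h) = ε h) (hφu : φ u = u)
    (hφφ : ∀ h, φ (φ h) = u * h * u⁻¹)
    (hu : ∀ n : ℤ, n ≠ 0 → ¬ ∀ h, u ^ n * h = h * u ^ n) :
    (∀ h, φ h = h ↔ h * u = u * h) ∧
    ∃ a s : G, Commute a s ∧ φ a = a ∧ φ s = s ∧ (∀ h, φ h = h → ∃ i j : ℤ, h = a ^ i * s ^ j) ∧
      (∀ i j : ℤ, a ^ i * s ^ j = 1 → i = 0 ∧ j = 0) := by
  set P := Multiplicative.toAdd (ε z) with hP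
  have hP0 : P ≠ 0 := fun h => hεz (Multiplicative.toAdd.injective h)
  have hzc : ∀ (n : ℤ) h, Commute (z ^ n) h := fun n h => (show Commute z h from hz h).zpow_left n
  have hφzn : ∀ n : ℤ, φ (z ^ n) = z ^ n := fun n => by rw [map_zpow, hφz]
  have htf : ∀ (k : G) (n : ℤ), ε k = 1 → n ≠ 0 → k ^ n = 1 → k = 1 := by
    intro k n hk hn h
    have := free_tf (⟨k, hk⟩ : ε.ker) n hn (Subtype.ext (by simpa using h))
    exact congrArg Subtype.val this
  obtain ⟨f, hf⟩ : ∃ f, f = u ^ P * (z ^ (Multiplicative.toAdd (ε u)))⁻¹ := ⟨_, rfl⟩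
  have huf : u ^ P = f * z ^ (Multiplicative.toAdd (ε u)) := by rw [hf]; group
  have hεf : ε f = 1 := by rw [hf]; exact mem_or ε z u
  have hf1 : f ≠ 1 := by
    intro h
    refine hu P hP0 fun h' => ?_
    rw [huf, h, one_mul]
    exact hzc _ _
  have hφf : φ f = f := by rw [hf, map_mul, map_inv, map_zpow, hφu, hφzn]
  have hfu : ∀ h, Commute h u → Commute h f := fun h hh => by
    rw [hf]
    exact (hh.zpow_right _).mul_right (hzc _ _).symm.inv_right
  obtain ⟨a, hεa, ha⟩ : ∃ a, ε a = 1 ∧ ∀ h, ε h = 1 → Commute h f → ∃ n : ℤ, h = a ^ n := by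
    obtain ⟨a, ha⟩ := free_centralizer (⟨f, hεf⟩ : ε.ker) (fun h => hf1 (congrArg Subtype.val h))
    refine ⟨a, a.2, fun h hh hc => ?_⟩
    obtain ⟨n, hn⟩ := (ha ⟨h, hh⟩).1 (Subtype.ext hc)
    exact ⟨n, by simpa using (congrArg Subtype.val hn).symm⟩
  obtain ⟨m, hm⟩ := ha f hεf rfl
  have hm0 : m ≠ 0 := by rintro rfl; simp at hm; exact hf1 hm
  have ha1 : a ≠ 1 := by rintro rfl; simp at hm; exact hf1 hm
  have hainj : ∀ n : ℤ, a ^ n = 1 → n = 0 := fun n hn => by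
    by_contra h0
    exact ha1 (htf a n hεa h0 hn)
  have haf : Commute a f := by rw [hm]; exact (Commute.refl a).zpow_right m
  have key : ∀ b, ε b = 1 → Commute b f → b ^ m = f → b = a := by
    intro b hb hbf hbm
    obtain ⟨e, rfl⟩ := ha b hb hbf
    have h1 : a ^ (e * m - m) = 1 := by rw [zpow_sub, zpow_mul, hbm, ← hm, mul_inv_cancel]
    have h2 := hainj _ h1
    have h3 : (e - 1) * m = 0 := by linarith
    rcases mul_eq_zero.1 h3 with h | h
    · rw [show e = 1 by omega, zpow_one]
    · exact absurd h hm0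
  -- elements commuting with f commute with a
  have hca : ∀ h, Commute h f → Commute h a := by
    intro h hh
    have h1 : h * f * h⁻¹ = f := by rw [hh.eq]; group
    have h2 : h * a * h⁻¹ = a := by
      apply key
      · simp [hεa]
      · have h3 := haf.map (MulAut.conj h)
        simp only [MulAut.conj_apply] at h3
        rwa [h1] at h3
      · rw [conj_zpow, ← hm, h1]
    exact mul_inv_eq_iff_eq_mul.1 h2
  have hpow : ∀ h, Commute h f → ∃ j n : ℤ, h ^ P = a ^ j * z ^ n := by
    intro h hh
    obtain ⟨j, hj⟩ := ha _ (mem_or ε z h) ((hh.zpow_left _).mul_left (hzc _ _).inv_left)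
    exact ⟨j, _, mul_inv_eq_iff_eq_mul.1 hj⟩
  have key2 : ∀ h h', Commute h f → Commute h' f → ε h = ε h' → h ^ P = h' ^ P → h = h' := by
    intro h h' hh hh' he hp
    obtain ⟨k, hk⟩ := ha (h * h'⁻¹) (by simp [he]) (hh.mul_left hh'.inv_left)
    have h1 : h = a ^ k * h' := mul_inv_eq_iff_eq_mul.1 hk
    have h2 : h ^ P = a ^ (k * P) * h' ^ P := by
      rw [h1, ((hca h' hh').symm.zpow_left k).mul_zpow, zpow_mul]
    rw [hp] at h2
    have h3 := hainj _ (right_eq_mul.1 h2)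
    rcases mul_eq_zero.1 h3 with h | h
    · rw [h1, h]; simp
    · exact absurd h hP0
  have habel : ∀ h h', Commute h f → Commute h' f → Commute h h' := by
    intro h h' hh hh'
    have : h * h' * h⁻¹ = h' := by
      apply key2
      · exact (hh.mul_left hh').mul_left hh.inv_left
      · exact hh'
      · simp
      · rw [conj_zpow]
        obtain ⟨j, n, hjn⟩ := hpow h' hh'
        have : Commute h (h' ^ P) := by
          rw [hjn]
          exact ((hca h hh).zpow_right _).mul_right (hzc _ _).symm
        rw [this.eq]; group
    exact mul_inv_eq_iff_eq_mul.1 this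
  have hcu : ∀ h, Commute h u ↔ Commute h f := fun h =>
    ⟨hfu h, fun hh => habel h u hh (hfu u rfl)⟩
  have hφa : φ a = a := by
    apply key
    · rw [hφε, hεa]
    · have := haf.map φ
      rwa [hφf] at this
    · rw [← map_zpow, ← hm, hφf]
  have hfix : ∀ h, φ h = h ↔ Commute h f := by
    intro h
    constructor
    · intro hh
      rw [← hcu]
      have := hφφ h
      rw [hh, hh] at this
      exact (eq_mul_inv_iff_mul_eq.1 this)
    · intro hh
      apply key2 _ _ _ hh (hφε h)
      · obtain ⟨j, n, hjn⟩ := hpow h hh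
        rw [← map_zpow, hjn, map_mul, map_zpow, hφa, hφzn]
      · have := hh.map φ
        rwa [hφf] at this
  refine ⟨fun h => (hfix h).trans (hcu h).symm, ?_⟩
  have hs : ∃ s, Commute s f ∧ ∀ h, Commute h f → ∃ j : ℤ, ε h = ε s ^ j := by
    obtain ⟨⟨g, s, hs, rfl⟩, hg⟩ := (inferInstance : IsCyclic ((Subgroup.centralizer {f}).map ε)).exists_generator
    refine ⟨s, Subgroup.mem_centralizer_singleton_iff.1 hs, fun h hh => ?_⟩
    obtain ⟨j, hj⟩ := hg ⟨ε h, h, Subgroup.mem_centralizer_singleton_iff.2 hh, rfl⟩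
    exact ⟨j, by simpa using (congrArg Subtype.val hj).symm⟩
  obtain ⟨s, hsf, hs⟩ := hs
  have hs1 : ε s ≠ 1 := by
    intro h
    obtain ⟨j, hj⟩ := hs z (hz f)
    rw [h, one_zpow] at hj
    exact hεz hj
  refine ⟨a, s, (hca s hsf).symm, hφa, (hfix s).2 hsf, fun h hh => ?_, fun i j hij => ?_⟩
  · rw [hfix] at hh
    obtain ⟨j, hj⟩ := hs h hh
    obtain ⟨i, hi⟩ := ha (h * (s ^ j)⁻¹) (by simp [hj]) (hh.mul_left (hsf.zpow_left j).inv_left)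
    exact ⟨i, j, mul_inv_eq_iff_eq_mul.1 hi⟩
  · have h1 := congrArg ε hij
    rw [map_mul, map_zpow, map_zpow, hεa, one_zpow, one_mul, map_one] at h1
    have hj : j = 0 := by
      have h2 := congrArg Multiplicative.toAdd h1
      simp only [toAdd_zpow, toAdd_one, smul_eq_mul, mul_eq_zero] at h2
      rcases h2 with h | h
      · exact h
      · exact absurd (Multiplicative.toAdd.injective h) hs1
    subst hj
    rw [zpow_zero, mul_one] at hij
    exact ⟨hainj _ hij, rfl⟩
end abstractPart
end TKGaux
namespace TKGaux
section model
variable (p : ℕ)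

abbrev FF : Type := FreeGroup {i : ZMod p // i ≠ 0}

open Classical in
noncomputable def vv (i : ZMod p) : FF p := if h : i = 0 then 1 else FreeGroup.of ⟨i, h⟩

lemma vv_zero : vv p 0 = 1 := by simp [vv]

lemma vv_ne (i : {i : ZMod p // i ≠ 0}) : vv p i = FreeGroup.of i := by
  simp [vv, i.2]

noncomputable def al (k : ZMod p) : FF p →* FF p :=
  FreeGroup.lift (fun i => (vv p k)⁻¹ * vv p (i + k))

lemma al_vv (k i : ZMod p) : al p k (vv p i) = (vv p k)⁻¹ * vv p (i + k) := by
  by_cases h : i = 0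
  · subst h; simp [vv_zero]
  · have := vv_ne p ⟨i, h⟩
    simp only at this
    rw [this, al, FreeGroup.lift_apply_of]

lemma al_al (k l : ZMod p) (w : FF p) : al p k (al p l w) = al p (l + k) w := by
  have : (al p k).comp (al p l) = al p (l + k) := by
    apply FreeGroup.ext_hom
    intro i
    rw [← vv_ne, MonoidHom.comp_apply, al_vv, al_vv, map_mul, map_inv, al_vv, al_vv]
    rw [add_assoc]; group
  exact DFunLike.congr_fun this w

lemma al_zero (w : FF p) : al p 0 w = w := by
  have : al p 0 = MonoidHom.id _ := by
    apply FreeGroup.ext_hom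
    intro i
    rw [← vv_ne, al_vv, vv_zero]; simp
  rw [this]; rfl

noncomputable def alE (k : ZMod p) : MulAut (FF p) where
  toFun := al p k
  invFun := al p (-k)
  left_inv w := by rw [al_al, add_neg_cancel, al_zero]
  right_inv w := by rw [al_al, neg_add_cancel, al_zero]
  map_mul' := map_mul _

noncomputable def psi : Multiplicative ℤ →* MulAut (FF p) where
  toFun n := alE p ((Multiplicative.toAdd n : ℤ) : ZMod p)
  map_one' := by
    apply MulEquiv.ext
    intro w
    change al p ((0 : ℤ) : ZMod p) w = w
    rw [Int.cast_zero, al_zero]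
  map_mul' m n := by
    ext w
    change al p _ w = al p _ (al p _ w)
    rw [al_al]; push_cast [toAdd_mul]; rw [add_comm]

lemma psi_apply (n : ℤ) (w : FF p) : psi p (Multiplicative.ofAdd n) w = al p n w := rfl

abbrev MM : Type := FF p ⋊[psi p] (Multiplicative ℤ)

noncomputable def mx : MM p := ⟨1, Multiplicative.ofAdd 1⟩
noncomputable def my : MM p := ⟨vv p 1, Multiplicative.ofAdd 1⟩

lemma mx_pow (n : ℕ) : mx p ^ n = ⟨1, Multiplicative.ofAdd (n : ℤ)⟩ := by
  induction n with
  | zero => rfl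
  | succ n ih =>
    rw [pow_succ, ih, mx, SemidirectProduct.mul_def]
    ext
    · simp
    · simp

lemma my_pow (n : ℕ) : my p ^ n = ⟨vv p n, Multiplicative.ofAdd (n : ℤ)⟩ := by
  induction n with
  | zero => simp [vv_zero]
  | succ n ih =>
    rw [pow_succ, ih, my, SemidirectProduct.mul_def]
    ext
    · simp only [psi_apply, al_vv]
      push_cast
      rw [add_comm 1 (n : ZMod p), mul_inv_cancel_left]
    · simp

noncomputable def Th : TKG p p →* MM p :=
  PresentedGroup.toGroup (f := fun b => if b then mx p else my p) (by
    intro r hr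
    rw [Set.mem_singleton_iff] at hr
    subst hr
    simp [mx_pow, my_pow, vv_zero])

lemma Th_x : Th p (TKx p p) = mx p := by
  exact (PresentedGroup.toGroup.of _).trans (by simp)
lemma Th_y : Th p (TKy p p) = my p := by
  exact (PresentedGroup.toGroup.of _).trans (by simp)

lemma xy : TKx p p ^ p = TKy p p ^ p := by
  have h : (PresentedGroup.mk _ (FreeGroup.of true ^ p * (FreeGroup.of false ^ p)⁻¹) :
    PresentedGroup ({FreeGroup.of true ^ p * (FreeGroup.of false ^ p)⁻¹} : Set (FreeGroup Bool))) = 1 :=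
    PresentedGroup.one_of_mem rfl
  rw [map_mul, map_inv, map_pow, map_pow] at h
  exact mul_inv_eq_one.1 h

lemma hom_ext {H : Type} [Group H] (f g : TKG p p →* H) (hx : f (TKx p p) = g (TKx p p))
    (hy : f (TKy p p) = g (TKy p p)) : f = g := by
  refine PresentedGroup.ext (φ := f) (ψ := g) ?_
  rintro (_ | _)
  · exact hy
  · exact hx

lemma z_central (h : TKG p p) : TKx p p ^ p * h = h * TKx p p ^ p := by
  have : (MulAut.conj (TKx p p ^ p)).toMonoidHom = MonoidHom.id _ := by
    apply hom_ext
    · change TKx p p ^ p * TKx p p * (TKx p p ^ p)⁻¹ = TKx p p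
      rw [← pow_succ, pow_succ', mul_inv_cancel_right]
    · change TKx p p ^ p * TKy p p * (TKx p p ^ p)⁻¹ = TKy p p
      rw [xy, ← pow_succ, pow_succ', mul_inv_cancel_right]
  have := DFunLike.congr_fun this h
  simp only [MulEquiv.toMonoidHom_eq_coe, MonoidHom.coe_coe, MulAut.conj_apply, MonoidHom.id_apply] at this
  exact mul_inv_eq_iff_eq_mul.1 this

noncomputable def bk (n : ℤ) : TKG p p := TKy p p ^ n * (TKx p p ^ n)⁻¹

lemma bk_add (n m : ℤ) : bk p (n + p * m) = bk p n := by
  have h : TKy p p ^ ((p : ℤ) * m) = TKx p p ^ ((p : ℤ) * m) := by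
    rw [zpow_mul, zpow_mul, zpow_natCast, zpow_natCast, xy]
  rw [bk, bk, zpow_add, zpow_add, h]; group

lemma bk_congr (n m : ℤ) (h : (n : ZMod p) = m) : bk p n = bk p m := by
  obtain ⟨c, hc⟩ := (ZMod.intCast_eq_intCast_iff_dvd_sub _ _ _).1 h
  rw [show m = n + p * c by linarith, bk_add]

noncomputable def bF : FF p →* TKG p p := FreeGroup.lift (fun i => bk p (i.1.cast : ℤ))

lemma bF_vv (i : ZMod p) (n : ℤ) (h : (n : ZMod p) = i) : bF p (vv p i) = bk p n := by
  by_cases h0 : i = 0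
  · subst h0
    rw [vv_zero, map_one, bk_congr p n 0 (by simpa using h)]; simp [bk]
  · have := vv_ne p ⟨i, h0⟩
    simp only at this
    rw [this, bF, FreeGroup.lift_apply_of]
    exact bk_congr _ _ _ (by simp [h])

noncomputable def Bk : MM p →* TKG p p :=
  SemidirectProduct.lift (bF p) (zpowersHom _ (TKx p p)) (by
    intro n
    apply FreeGroup.ext_hom
    intro i
    obtain ⟨k, hk⟩ := ZMod.intCast_surjective i.1
    obtain ⟨n, rfl⟩ := Multiplicative.ofAdd.surjective n
    rw [← vv_ne]
    simp only [MonoidHom.comp_apply, MulEquiv.coe_toMonoidHom, psi_apply, al_vv, map_mul, map_inv,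
      MulAut.conj_apply]
    rw [bF_vv p n n rfl, bF_vv p i k hk, bF_vv p (i + n) (k + n) (by simp [hk])]
    simp only [zpowersHom_apply, toAdd_ofAdd, bk]
    rw [add_comm k n, zpow_add, zpow_add]; group)

lemma Bk_Th (h : TKG p p) : Bk p (Th p h) = h := by
  have : (Bk p).comp (Th p) = MonoidHom.id _ := by
    apply hom_ext
    · simp [Th_x, Bk, mx, SemidirectProduct.mk_eq_inl_mul_inr]
    · simp [Th_y, Bk, my, SemidirectProduct.mk_eq_inl_mul_inr, bF_vv p 1 1, bk]
  exact DFunLike.congr_fun this h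

noncomputable def ep : TKG p p →* Multiplicative ℤ := SemidirectProduct.rightHom.comp (Th p)

lemma ep_x : ep p (TKx p p) = Multiplicative.ofAdd 1 := by
  simp [ep, Th_x, mx]
lemma ep_y : ep p (TKy p p) = Multiplicative.ofAdd 1 := by
  simp [ep, Th_y, my]

noncomputable def th : (ep p).ker →* FF p where
  toFun k := (Th p k.1).left
  map_one' := by simp
  map_mul' a b := by
    have : (Th p a.1).right = 1 := a.2
    simp [this]

lemma th_inj : Function.Injective (th p) := by
  intro a b h
  apply Subtype.ext
  rw [← Bk_Th p a.1, ← Bk_Th p b.1]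
  congr 1
  apply SemidirectProduct.ext
  · exact h
  · exact ((show (Th p a.1).right = 1 from a.2).trans (show (Th p b.1).right = 1 from b.2).symm)

instance : IsFreeGroup (ep p).ker :=
  IsFreeGroup.ofMulEquiv (MonoidHom.ofInjective (th_inj p)).symm

end model
end TKGaux

/-- If `ι_g ∘ σ` has infinite order, where `σ : x ↦ y, y ↦ x`, then
`Fix(ι_g ∘ σ) = C(g·σ(g)) ≅ ℤ × ℤ`, and it contains the central element `x^p`. -/
theorem TKG_fix_sigma_g_infinite_order (p : ℕ) (hp : 2 ≤ p)
    (σ : MulAut (TKG p p))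
    (hσx : σ (TKx p p) = TKy p p) (hσy : σ (TKy p p) = TKx p p)
    (g : TKG p p) (hinf : ¬ IsOfFinOrder (MulAut.conj g * σ)) :
    fixSubgroup (MulAut.conj g * σ) = Subgroup.centralizer {g * σ g} ∧
    Nonempty (↥(fixSubgroup (MulAut.conj g * σ)) ≃* Multiplicative (ℤ × ℤ)) ∧
    TKx p p ^ p ∈ fixSubgroup (MulAut.conj g * σ) := by
  have hσσ : ∀ h, σ (σ h) = h := by
    intro h
    have : (σ * σ).toMonoidHom = MonoidHom.id _ := by
      apply TKGaux.hom_ext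
      · simp [hσx, hσy]
      · simp [hσx, hσy]
    exact DFunLike.congr_fun this h
  have hεσ : ∀ h, TKGaux.ep p (σ h) = TKGaux.ep p h := by
    intro h
    have : (TKGaux.ep p).comp σ.toMonoidHom = TKGaux.ep p := by
      apply TKGaux.hom_ext
      · simp [hσx, TKGaux.ep_x, TKGaux.ep_y]
      · simp [hσy, TKGaux.ep_x, TKGaux.ep_y]
    exact DFunLike.congr_fun this h
  have hφ : ∀ h, (MulAut.conj g * σ) h = g * σ h * g⁻¹ := fun h => rfl
  generalize MulAut.conj g * σ = φ at *
  have hφz : φ (TKx p p ^ p) = TKx p p ^ p := by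
    rw [hφ, map_pow, hσx, ← TKGaux.xy, ← TKGaux.z_central, mul_inv_cancel_right]
  have hφφ : ∀ h, φ (φ h) = (g * σ g) * h * (g * σ g)⁻¹ := by
    intro h
    simp only [hφ, map_mul, map_inv, hσσ]; group
  have hφ2 : φ ^ 2 = MulAut.conj (g * σ g) := by
    ext h
    rw [pow_two]
    exact hφφ h
  obtain ⟨hC, a, s, has, hφa, hφs, hgen, hind⟩ := TKGaux.abs_main (TKGaux.ep p) (TKx p p ^ p) (g * σ g)
    (TKGaux.z_central p)
    (by
      rw [map_pow, TKGaux.ep_x]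
      intro h
      have := congrArg Multiplicative.toAdd h
      simp at this
      omega) φ hφz
    (fun h => by rw [hφ, map_mul, map_mul, hεσ, map_inv, mul_inv_cancel_comm])
    (by rw [hφ, map_mul, hσσ]; group) hφφ
    (by
      intro n hn hc
      apply hinf
      rw [isOfFinOrder_iff_zpow_eq_one]
      refine ⟨2 * n, by omega, ?_⟩
      rw [zpow_mul, show φ ^ (2 : ℤ) = φ ^ 2 from zpow_ofNat φ 2, hφ2, ← map_zpow]
      ext h
      rw [MulAut.conj_apply, hc, mul_inv_cancel_right]; rfl)
  have hmem : ∀ h, h ∈ fixSubgroup φ ↔ φ h = h := fun h => Iff.rfl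
  refine ⟨?_, ⟨?_⟩, hφz⟩
  · ext h
    rw [hmem, hC, Subgroup.mem_centralizer_singleton_iff]
  · let F : Multiplicative (ℤ × ℤ) →* fixSubgroup φ :=
      { toFun := fun n => ⟨a ^ (Multiplicative.toAdd n).1 * s ^ (Multiplicative.toAdd n).2, by
          rw [hmem, map_mul, map_zpow, map_zpow, hφa, hφs]⟩
        map_one' := Subtype.ext (by simp)
        map_mul' := fun m n => Subtype.ext (by
          simp only [toAdd_mul, Prod.fst_add, Prod.snd_add, zpow_add, Subgroup.coe_mul]
          have := (has.zpow_zpow (Multiplicative.toAdd n).1 (Multiplicative.toAdd m).2).eq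
          simp only [mul_assoc]
          congr 1
          rw [← mul_assoc, ← mul_assoc, this]) }
    refine (MulEquiv.ofBijective F ⟨?_, ?_⟩).symm
    · rw [injective_iff_map_eq_one]
      intro n hn
      obtain ⟨h1, h2⟩ := hind _ _ (congrArg Subtype.val hn)
      exact Multiplicative.toAdd.injective (Prod.ext h1 h2)
    · rintro ⟨h, hh⟩
      obtain ⟨i, j, hij⟩ := hgen h hh
      exact ⟨Multiplicative.ofAdd (i, j), Subtype.ext hij.symm⟩
end

section
/- Let p ≥ 2 and G_{p,p} = ⟨x, y | x^p = y^p⟩, and let ψ be the automorphism with ψ(x) = y⁻¹, ψ(y) = x⁻¹ (i.e. ψ = σ∘τ). Suppose ι_g ∘ ψ has infinite order in Aut(G_{p,p}) (equivalently g·ψ(g) ∉ Z(G_{p,p})). Then the fixed subgroup Fix(ι_g ∘ ψ) is infinite cyclic, contains g·ψ(g), and contains every cyclic subgroup of G_{p,p} containing g·ψ(g); that is, Fix(ι_g ∘ ψ) is the maximal cyclic subgroup containing g·ψ(g). -/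
namespace TKaux

lemma isCyclic_of_comm {H : Type*} [Group H] [IsFreeGroup H] (hc : ∀ a b : H, a * b = b * a) :
    IsCyclic H := by
  have hss : Subsingleton (IsFreeGroup.Generators H) := by
    by_contra hne
    rw [not_subsingleton_iff_nontrivial] at hne
    obtain ⟨a, b, hab⟩ := hne
    classical
    have h := hc (IsFreeGroup.of a) (IsFreeGroup.of b)
    have h2 := congrArg (IsFreeGroup.lift (fun i => if i = a then
      (Equiv.swap (0 : Fin 3) 1) else Equiv.swap (1 : Fin 3) 2)) h
    simp only [map_mul, IsFreeGroup.lift_of, if_true, if_neg hab.symm] at h2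
    revert h2
    decide
  have hc : IsCyclic (FreeGroup (IsFreeGroup.Generators H)) := by
    rcases isEmpty_or_nonempty (IsFreeGroup.Generators H) with h | ⟨⟨a⟩⟩
    · infer_instance
    · haveI : Unique (IsFreeGroup.Generators H) := ⟨⟨a⟩, fun _ => Subsingleton.elim _ _⟩
      infer_instance
  exact isCyclic_of_injective (IsFreeGroup.toFreeGroup H).toMonoidHom
    (IsFreeGroup.toFreeGroup H).injective

lemma common_root {X : Type*} {a b : FreeGroup X} (h : a * b = b * a) :
    ∃ z : FreeGroup X, ∃ m n : ℤ, z ^ m = a ∧ z ^ n = b := by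
  let S := Subgroup.closure ({a, b} : Set (FreeGroup X))
  have hcomm : ∀ u v : S, u * v = v * u := by
    have hS : IsMulCommutative S := Subgroup.isMulCommutative_closure (by
      rintro u (rfl | rfl) v (rfl | rfl) <;> first | rfl | exact h | exact h.symm)
    intro u v
    exact hS.is_comm.comm u v
  obtain ⟨z, hz⟩ := (isCyclic_of_comm hcomm).exists_generator
  obtain ⟨m, hm⟩ := hz ⟨a, Subgroup.subset_closure (by simp)⟩
  obtain ⟨n, hn⟩ := hz ⟨b, Subgroup.subset_closure (by simp)⟩
  exact ⟨z, m, n, by simpa using congrArg Subtype.val hm, by simpa using congrArg Subtype.val hn⟩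

lemma comm_of {X : Type*} (a : X) {u : FreeGroup X}
    (h : FreeGroup.of a * u = u * FreeGroup.of a) : ∃ k : ℤ, u = FreeGroup.of a ^ k := by
  obtain ⟨z, m, n, hm, hn⟩ := common_root h
  have h1 := congrArg (FreeGroup.lift (fun _ => Multiplicative.ofAdd (1 : ℤ))) hm
  rw [map_zpow, FreeGroup.lift_apply_of] at h1
  have h2 := congrArg Multiplicative.toAdd h1
  simp only [toAdd_zpow, toAdd_ofAdd, smul_eq_mul] at h2
  rcases Int.eq_one_or_neg_one_of_mul_eq_one h2 with hm1 | hm1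
  · subst hm1
    exact ⟨n, by rw [← hn, ← hm]; simp⟩
  · subst hm1
    exact ⟨-n, by rw [← hn, ← hm]; simp⟩

lemma subsingleton_of_central {X : Type*} {u : FreeGroup X} (hu : u ≠ 1)
    (hc : ∀ v, v * u = u * v) : Subsingleton X := by
  classical
  refine ⟨fun a b => ?_⟩
  by_contra hab
  obtain ⟨k, hk⟩ := comm_of a (hc _)
  obtain ⟨l, hl⟩ := comm_of b (hc _)
  have h1 := congrArg (FreeGroup.lift
    (fun i => if i = a then Multiplicative.ofAdd (1 : ℤ) else 1)) (hk.symm.trans hl)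
  rw [map_zpow, map_zpow, FreeGroup.lift_apply_of, FreeGroup.lift_apply_of, if_pos rfl,
    if_neg (Ne.symm hab), one_zpow] at h1
  have h2 := congrArg Multiplicative.toAdd h1
  simp only [toAdd_zpow, toAdd_ofAdd, smul_eq_mul, mul_one, toAdd_one] at h2
  subst h2
  exact hu (by simpa using hk)

/-- Centralizers of non-trivial elements in free groups are cyclic. -/
lemma centralizer_cyclic {X : Type*} {u : FreeGroup X} (hu : u ≠ 1) :
    IsCyclic (Subgroup.centralizer ({u} : Set (FreeGroup X))) := by
  let C := Subgroup.centralizer ({u} : Set (FreeGroup X))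
  let e := IsFreeGroup.toFreeGroup C
  have huC : u ∈ C := by simp [C, Subgroup.mem_centralizer_iff]
  have hss : Subsingleton (IsFreeGroup.Generators C) := by
    refine subsingleton_of_central (u := e ⟨u, huC⟩) ?_ ?_
    · intro h
      rw [map_eq_one_iff e e.injective] at h
      exact hu (congrArg Subtype.val h)
    · intro v
      obtain ⟨w, rfl⟩ := e.surjective v
      rw [← map_mul, ← map_mul]
      congr 1
      ext1
      exact (Subgroup.mem_centralizer_iff.1 w.2 u rfl).symm
  have hc : IsCyclic (FreeGroup (IsFreeGroup.Generators C)) := by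
    rcases isEmpty_or_nonempty (IsFreeGroup.Generators C) with h | ⟨⟨a⟩⟩
    · infer_instance
    · haveI : Unique (IsFreeGroup.Generators C) := ⟨⟨a⟩, fun _ => Subsingleton.elim _ _⟩
      infer_instance
  exact isCyclic_of_injective e.toMonoidHom e.injective

/-- The action of `ℤ` on the free group on `ZMod p` by shifting the generators. -/
def shift (p : ℕ) : Multiplicative ℤ →* MulAut (FreeGroup (ZMod p)) where
  toFun n := FreeGroup.freeGroupCongr (Equiv.addRight ((n.toAdd : ℤ) : ZMod p))
  map_one' := by
    ext w
    simp
  map_mul' m n := by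
    rw [MulAut.mul_def, FreeGroup.freeGroupCongr_trans]
    congr 1
    ext i
    simp [add_comm, add_left_comm, add_assoc]

lemma shift_of (p : ℕ) (n : Multiplicative ℤ) (i : ZMod p) :
    shift p n (FreeGroup.of i) = FreeGroup.of (i + ((n.toAdd : ℤ) : ZMod p)) := by
  simp [shift]

abbrev Big (p : ℕ) := FreeGroup (ZMod p) ⋊[shift p] Multiplicative ℤ

def tt (p : ℕ) : Big p := SemidirectProduct.inr (Multiplicative.ofAdd 1)
def T0 (p : ℕ) : Big p := SemidirectProduct.inl (FreeGroup.of 0)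

lemma tt_pow_comm (p : ℕ) : tt p ^ p * T0 p = T0 p * tt p ^ p := by
  rw [tt, T0, ← map_pow]
  have hn : ((Multiplicative.ofAdd (1 : ℤ) ^ p).toAdd : ZMod p) = 0 := by simp
  generalize Multiplicative.ofAdd (1 : ℤ) ^ p = n at hn ⊢
  ext1
  · simp [shift_of, hn]
  · simp

def gens (p : ℕ) : Bool → Big p
  | true => tt p
  | false => (T0 p)⁻¹ * tt p * T0 p

lemma gens_rel (p : ℕ) : ∀ r ∈ ({FreeGroup.of true ^ p * (FreeGroup.of false ^ p)⁻¹} :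
    Set (FreeGroup Bool)), FreeGroup.lift (gens p) r = 1 := by
  rintro r rfl
  rw [map_mul, map_inv, map_pow, map_pow, FreeGroup.lift_apply_of, FreeGroup.lift_apply_of,
    mul_inv_eq_one]
  have : gens p false = (T0 p)⁻¹ * tt p * (T0 p)⁻¹⁻¹ := by simp [gens]
  rw [this, conj_pow, inv_inv, mul_assoc, tt_pow_comm]
  simp [gens]

def Phi (p : ℕ) : TKG p p →* Big p := PresentedGroup.toGroup (gens_rel p)

lemma Phi_x (p : ℕ) : Phi p (TKx p p) = tt p := PresentedGroup.toGroup.of (gens_rel p)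
lemma Phi_y (p : ℕ) : Phi p (TKy p p) = (T0 p)⁻¹ * tt p * T0 p :=
  PresentedGroup.toGroup.of (gens_rel p)

lemma rel (p : ℕ) : TKx p p ^ p = TKy p p ^ p := by
  have h := PresentedGroup.one_of_mem (rels := ({FreeGroup.of true ^ p *
    (FreeGroup.of false ^ p)⁻¹} : Set (FreeGroup Bool))) (Set.mem_singleton _)
  rw [map_mul, map_inv, map_pow, map_pow, mul_inv_eq_one] at h
  exact h

lemma closure_xy (p : ℕ) : Subgroup.closure ({TKx p p, TKy p p} : Set (TKG p p)) = ⊤ := by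
  have h := PresentedGroup.closure_range_of ({FreeGroup.of true ^ p *
    (FreeGroup.of false ^ p)⁻¹} : Set (FreeGroup Bool))
  refine top_le_iff.1 (h.symm.le.trans ((Subgroup.closure_le _).2 ?_))
  rintro _ ⟨b, rfl⟩
  apply Subgroup.subset_closure
  cases b
  · exact Or.inr rfl
  · exact Or.inl rfl

def ss (p : ℕ) (i : ZMod p) : TKG p p := TKy p p ^ (i.val : ℤ) * (TKx p p ^ (i.val : ℤ))⁻¹

lemma ss_cast (p : ℕ) (hp : 2 ≤ p) (n : ℤ) :
    ss p (n : ZMod p) = TKy p p ^ n * (TKx p p ^ n)⁻¹ := by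
  haveI : NeZero p := ⟨by omega⟩
  rw [ss, ZMod.val_intCast]
  have e : n = n % p + p * (n / p) := (Int.emod_add_mul_ediv n p).symm
  conv_rhs => rw [e]
  rw [zpow_add, zpow_add, zpow_mul (TKx p p) p, zpow_mul (TKy p p) p, zpow_natCast, zpow_natCast,
    rel]
  group

def rho (p : ℕ) : FreeGroup (ZMod p) →* TKG p p := FreeGroup.lift (ss p)

def recon (p : ℕ) (b : Big p) : TKG p p := rho p b.left * TKx p p ^ (b.right.toAdd : ℤ)

lemma recon_x (p : ℕ) (b : Big p) : recon p (b * tt p) = recon p b * TKx p p := by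
  simp [recon, tt, zpow_add, mul_assoc]

lemma recon_y (p : ℕ) (hp : 2 ≤ p) (b : Big p) :
    recon p (b * ((T0 p)⁻¹ * tt p * T0 p)) = recon p b * TKy p p := by
  have h0 := ss_cast p hp b.right.toAdd
  have h1 := ss_cast p hp (b.right.toAdd + 1)
  push_cast at h1
  simp only [recon, tt, T0, rho, SemidirectProduct.mul_left, SemidirectProduct.mul_right,
    SemidirectProduct.inv_left, SemidirectProduct.inv_right, SemidirectProduct.left_inl,
    SemidirectProduct.right_inl, SemidirectProduct.left_inr, SemidirectProduct.right_inr,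
    map_mul, map_inv, shift_of, FreeGroup.lift_apply_of, map_one, inv_one, one_mul, mul_one,
    toAdd_mul, toAdd_ofAdd, toAdd_one, MulAut.one_apply, Int.cast_one, zero_add]
  rw [add_comm (1 : ZMod p), h0, h1, zpow_add, zpow_add]
  group

lemma recon_Phi (p : ℕ) (hp : 2 ≤ p) (h : TKG p p) : recon p (Phi p h) = h := by
  have hh : h ∈ Subgroup.closure ({TKx p p, TKy p p} : Set (TKG p p)) := by
    rw [closure_xy]; trivial
  induction hh using Subgroup.closure_induction_right with
  | one => simp [recon]
  | mul_right a ha b hb ih =>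
    rcases hb with rfl | rfl
    · rw [map_mul, Phi_x, recon_x, ih]
    · rw [map_mul, Phi_y, recon_y p hp, ih]
  | mul_inv_cancel a ha b hb ih =>
    rcases hb with rfl | rfl
    · rw [eq_mul_inv_iff_mul_eq, ← recon_x, ← Phi_x, ← map_mul, inv_mul_cancel_right, ih]
    · rw [eq_mul_inv_iff_mul_eq, ← recon_y p hp, ← Phi_y, ← map_mul, inv_mul_cancel_right, ih]

lemma Phi_injective (p : ℕ) (hp : 2 ≤ p) : Function.Injective (Phi p) :=
  Function.LeftInverse.injective (recon_Phi p hp)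

/-- The degree homomorphism. -/
def chi (p : ℕ) : TKG p p →* Multiplicative ℤ := SemidirectProduct.rightHom.comp (Phi p)

/-- The kernel of the degree map embeds in a free group. -/
def emb (p : ℕ) : (chi p).ker →* FreeGroup (ZMod p) where
  toFun h := (Phi p h).left
  map_one' := by simp
  map_mul' a b := by
    have ha : (Phi p (a : TKG p p)).right = 1 := a.2
    simp [ha]

lemma emb_injective (p : ℕ) (hp : 2 ≤ p) : Function.Injective (emb p) := by
  intro a b h
  apply Subtype.ext
  apply Phi_injective p hp
  ext1
  · exact h
  · have ha : (Phi p (a : TKG p p)).right = 1 := a.2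
    have hb : (Phi p (b : TKG p p)).right = 1 := b.2
    rw [ha, hb]

lemma hom_ext {p : ℕ} {M : Type*} [Monoid M] {f g : TKG p p →* M}
    (hx : f (TKx p p) = g (TKx p p)) (hy : f (TKy p p) = g (TKy p p)) : f = g :=
  MonoidHom.eq_of_eqOn_dense (closure_xy p) (by
    rintro _ (rfl | rfl)
    · exact hx
    · exact hy)

end TKaux

/-- If `ι_g ∘ ψ` has infinite order, where `ψ = σ∘τ : x ↦ y⁻¹, y ↦ x⁻¹`, then
`Fix(ι_g ∘ ψ)` is infinite cyclic, contains `g·ψ(g)`, and contains every cyclic subgroup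
containing `g·ψ(g)`: it is the maximal cyclic subgroup containing `g·ψ(g)`. -/
theorem TKG_fix_sigma_tau_g_infinite_order (p : ℕ) (hp : 2 ≤ p)
    (ψ : MulAut (TKG p p))
    (hψx : ψ (TKx p p) = (TKy p p)⁻¹) (hψy : ψ (TKy p p) = (TKx p p)⁻¹)
    (g : TKG p p) (hinf : ¬ IsOfFinOrder (MulAut.conj g * ψ)) :
    (∃ z : TKG p p, ¬ IsOfFinOrder z ∧
        fixSubgroup (MulAut.conj g * ψ) = Subgroup.zpowers z) ∧
    g * ψ g ∈ fixSubgroup (MulAut.conj g * ψ) ∧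
    ∀ w : TKG p p, g * ψ g ∈ Subgroup.zpowers w →
        Subgroup.zpowers w ≤ fixSubgroup (MulAut.conj g * ψ) := by
  have hψψ : ∀ h, ψ (ψ h) = h := by
    have : (ψ.toMonoidHom).comp ψ.toMonoidHom = MonoidHom.id _ :=
      TKaux.hom_ext (by simp [hψx, hψy]) (by simp [hψx, hψy])
    exact fun h => DFunLike.congr_fun this h
  have hχψ : ∀ h, TKaux.chi p (ψ h) = (TKaux.chi p h)⁻¹ := by
    have : (TKaux.chi p).comp ψ.toMonoidHom = (TKaux.chi p)⁻¹ :=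
      TKaux.hom_ext
        (by simp [hψx, TKaux.chi, TKaux.Phi_x, TKaux.Phi_y, TKaux.tt, TKaux.T0])
        (by simp [hψy, TKaux.chi, TKaux.Phi_x, TKaux.Phi_y, TKaux.tt, TKaux.T0])
    exact fun h => DFunLike.congr_fun this h
  set φ : MulAut (TKG p p) := MulAut.conj g * ψ with hφ
  have hφa : ∀ h, φ h = g * ψ h * g⁻¹ := fun h => by simp [hφ]
  have hχφ : ∀ h, TKaux.chi p (φ h) = (TKaux.chi p h)⁻¹ := fun h => by
    rw [hφa, map_mul, map_mul, map_inv, hχψ, mul_right_comm, mul_inv_cancel, one_mul]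
  set u := g * ψ g with hu
  have hφφ : ∀ h, φ (φ h) = u * h * u⁻¹ := fun h => by
    simp [hφa, hψψ, hu, mul_assoc]
  have hu1 : u ≠ 1 := by
    intro h1
    apply hinf
    rw [isOfFinOrder_iff_pow_eq_one]
    refine ⟨2, by norm_num, ?_⟩
    ext h
    rw [pow_two, MulAut.mul_apply, hφφ, h1]
    simp
  have hφu : φ u = u := by simp [hφa, hu, hψψ, mul_assoc]
  have hker : ∀ h, φ h = h → h ∈ (TKaux.chi p).ker := by
    intro h hh
    have h1 := hχφ h
    rw [hh] at h1
    have h2 := congrArg Multiplicative.toAdd h1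
    rw [toAdd_inv] at h2
    have h3 : Multiplicative.toAdd (TKaux.chi p h) = 0 := by omega
    rw [MonoidHom.mem_ker]
    exact Multiplicative.toAdd.injective h3
  have huK := hker u hφu
  have hinj := TKaux.emb_injective p hp
  have hfu : TKaux.emb p ⟨u, huK⟩ ≠ 1 := by
    intro h
    rw [map_eq_one_iff _ hinj] at h
    exact hu1 (congrArg Subtype.val h)
  refine ⟨?_, hφu, ?_⟩
  · let ι : fixSubgroup φ →* (TKaux.chi p).ker :=
      Subgroup.inclusion (fun h hh => hker h hh)
    let j : fixSubgroup φ →* Subgroup.centralizer ({TKaux.emb p ⟨u, huK⟩} : Set _) :=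
      ((TKaux.emb p).comp ι).codRestrict _ (by
        intro h
        rw [Subgroup.mem_centralizer_iff]
        rintro _ rfl
        rw [MonoidHom.comp_apply, ← map_mul, ← map_mul]
        congr 1
        ext1
        have hh : φ h = h := h.2
        have h2 := hφφ h
        rw [hh, hh] at h2
        exact (eq_mul_inv_iff_mul_eq.1 h2).symm)
    have hj : Function.Injective j := by
      intro a b hab
      have h1 : TKaux.emb p (ι a) = TKaux.emb p (ι b) := congrArg Subtype.val hab
      exact Subgroup.inclusion_injective _ (hinj h1)
    haveI := TKaux.centralizer_cyclic hfu
    obtain ⟨z, hz⟩ := (isCyclic_of_injective j hj).exists_generator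
    refine ⟨z, ?_, ?_⟩
    · intro hfin
      rw [isOfFinOrder_iff_pow_eq_one] at hfin
      obtain ⟨n, hn, hzn⟩ := hfin
      have hzK := hker z z.2
      have h1 : TKaux.emb p ⟨z, hzK⟩ ^ n = 1 := by
        rw [← map_pow, map_eq_one_iff _ hinj]
        exact Subtype.ext hzn
      have h2 := (pow_eq_one_iff_left hn.ne').1 h1
      rw [map_eq_one_iff _ hinj] at h2
      have h3 : (z : TKG p p) = 1 := congrArg Subtype.val h2
      obtain ⟨k, hk⟩ := hz ⟨u, hφu⟩
      have h4 : (z : TKG p p) ^ k = u := by simpa using congrArg Subtype.val hk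
      rw [h3, one_zpow] at h4
      exact hu1 h4.symm
    · ext h
      constructor
      · intro hh
        obtain ⟨k, hk⟩ := hz ⟨h, hh⟩
        exact ⟨k, by simpa using congrArg Subtype.val hk⟩
      · rintro ⟨k, rfl⟩
        exact zpow_mem z.2 k
  · rintro w ⟨k, hk⟩
    have hk : w ^ k = u := hk
    have hk0 : k ≠ 0 := by
      rintro rfl
      exact hu1 (by rw [← hk, zpow_zero])
    have hwK : w ∈ (TKaux.chi p).ker := by
      rw [MonoidHom.mem_ker]
      have h1 : TKaux.chi p w ^ k = 1 := by rw [← map_zpow, hk]; exact huK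
      have h2 := congrArg Multiplicative.toAdd h1
      simp only [toAdd_zpow, smul_eq_mul, toAdd_one, mul_eq_zero, hk0, false_or] at h2
      exact Multiplicative.toAdd.injective h2
    have hφwK : φ w ∈ (TKaux.chi p).ker := by
      rw [MonoidHom.mem_ker] at hwK ⊢
      rw [hχφ, hwK, inv_one]
    rw [Subgroup.zpowers_le]
    change φ w = w
    have h1 : TKaux.emb p ⟨φ w, hφwK⟩ ^ k = TKaux.emb p ⟨w, hwK⟩ ^ k := by
      rw [← map_zpow, ← map_zpow]
      congr 1
      ext1
      change φ w ^ k = w ^ k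
      rw [← map_zpow, hk, hφu]
    exact congrArg Subtype.val (hinj (zpow_left_injective hk0 h1))
end

section
/- Let p ≥ 2 and G_{p,p} = ⟨x, y | x^p = y^p⟩, and let σ be the automorphism with σ(x) = y, σ(y) = x. If ι_g ∘ σ has finite order in Aut(G_{p,p}) (equivalently g·σ(g) ∈ Z(G_{p,p})), then the fixed subgroup Fix(ι_g ∘ σ) equals the cyclic subgroup generated by x^p; in particular Fix(ι_g ∘ σ) ≅ ℤ. -/
namespace TKAux

open Monoid

/-- The free product of two copies of `A`. -/
abbrev FP (A : Type) [Group A] : Type := CoprodI (fun _ : Bool => A)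

abbrev Lt (A : Type) : Type := Σ _ : Bool, A

section
variable {A : Type} [Group A]

def Red (l : List (Lt A)) : Prop :=
  (∀ s ∈ l, s.2 ≠ 1) ∧ l.IsChain (fun s t => s.1 ≠ t.1)

def ofL (s : Lt A) : FP A := CoprodI.of (M := fun _ : Bool => A) (i := s.1) s.2

def pr (l : List (Lt A)) : FP A := (l.map ofL).prod

theorem pr_nil : pr ([] : List (Lt A)) = 1 := rfl
theorem pr_cons (a : Lt A) (l) : pr (a :: l) = ofL a * pr l := by simp [pr]
theorem pr_append (k l : List (Lt A)) : pr (k ++ l) = pr k * pr l := by simp [pr]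

theorem pr_inj {k l : List (Lt A)} (hk : Red k) (hl : Red l) (h : pr k = pr l) : k = l := by
  classical
  let wk : CoprodI.Word (fun _ : Bool => A) := ⟨k, hk.1, hk.2⟩
  let wl : CoprodI.Word (fun _ : Bool => A) := ⟨l, hl.1, hl.2⟩
  have h1 : wk.prod = wl.prod := h
  have h2 : wk = wl := CoprodI.Word.equiv.symm.injective h1
  exact congrArg CoprodI.Word.toList h2

theorem exists_red (g : FP A) : ∃ l, Red l ∧ pr l = g := by
  classical
  refine ⟨(CoprodI.Word.equiv g).toList, ⟨(CoprodI.Word.equiv g).ne_one,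
    (CoprodI.Word.equiv g).chain_ne⟩, ?_⟩
  exact CoprodI.Word.equiv.symm_apply_apply g

/-- The flip automorphism. -/
def sw : FP A →* FP A :=
  CoprodI.lift (fun i => CoprodI.of (M := fun _ : Bool => A) (i := !i))

def fl (s : Lt A) : Lt A := ⟨!s.1, s.2⟩

theorem sw_of (i : Bool) (a : A) :
    sw (CoprodI.of (M := fun _ : Bool => A) (i := i) a)
      = CoprodI.of (M := fun _ : Bool => A) (i := !i) a := by
  simp [sw]

theorem sw_ofL (s : Lt A) : sw (ofL s) = ofL (fl s) := sw_of _ _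

theorem fl_fl (s : Lt A) : fl (fl s) = s := by
  rcases s with ⟨i, a⟩; simp [fl]

theorem sw_pr (l : List (Lt A)) : sw (pr l) = pr (l.map fl) := by
  induction l with
  | nil => simp [pr]
  | cons a l ih => rw [pr_cons, map_mul, ih, List.map_cons, pr_cons, sw_ofL]

theorem red_fl {l : List (Lt A)} (h : Red l) : Red (l.map fl) := by
  refine ⟨?_, ?_⟩
  · intro s hs
    obtain ⟨t, ht, rfl⟩ := List.mem_map.1 hs
    exact h.1 t ht
  · rw [List.isChain_map]
    refine h.2.imp ?_
    intro a b hab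
    simpa [fl] using hab

theorem sw_sw (g : FP A) : sw (sw g) = g := by
  obtain ⟨l, -, rfl⟩ := exists_red g
  rw [sw_pr, sw_pr, List.map_map]
  congr 1
  conv_rhs => rw [← List.map_id l]
  apply List.map_congr_left
  intro a _
  exact fl_fl a

theorem sw_fix {w : FP A} (h : sw w = w) : w = 1 := by
  obtain ⟨l, hl, rfl⟩ := exists_red w
  rw [sw_pr] at h
  have := pr_inj (red_fl hl) hl h
  cases l with
  | nil => rfl
  | cons a l =>
    simp only [List.map_cons, List.cons.injEq] at this
    have h2 := congrArg Sigma.fst this.1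
    simp [fl] at h2

/-- Reduced with prescribed first and last indices. -/
def Q (i j : Bool) (l : List (Lt A)) : Prop :=
  Red l ∧ l.head?.map Sigma.fst = some i ∧ l.getLast?.map Sigma.fst = some j

theorem red_append {k l : List (Lt A)} (hk : Red k) (hl : Red l)
    (h : ∀ x ∈ k.getLast?, ∀ y ∈ l.head?, x.1 ≠ y.1) : Red (k ++ l) := by
  refine ⟨?_, List.isChain_append.2 ⟨hk.2, hl.2, h⟩⟩
  intro s hs
  rcases List.mem_append.1 hs with h | h
  · exact hk.1 s h
  · exact hl.1 s h

theorem Q.append {i j k m : Bool} {u v : List (Lt A)} (hu : Q i j u) (hv : Q k m v)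
    (hjk : j ≠ k) : Q i m (u ++ v) := by
  obtain ⟨ru, hu1, hu2⟩ := hu
  obtain ⟨rv, hv1, hv2⟩ := hv
  refine ⟨red_append ru rv ?_, ?_, ?_⟩
  · intro x hx y hy
    rw [Option.mem_def] at hx hy
    rw [hx] at hu2
    rw [hy] at hv1
    simp only [Option.map_some, Option.some.injEq] at hu2 hv1
    rw [hu2, hv1]; exact hjk
  · cases u with
    | nil => simp at hu1
    | cons a u => simpa using hu1
  · rcases List.eq_nil_or_concat v with rfl | ⟨v', b, rfl⟩
    · simp at hv2
    · rw [List.concat_eq_append] at *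
      rw [← List.append_assoc]
      simpa using hv2

theorem Q.fl {i j : Bool} {u : List (Lt A)} (hu : Q i j u) : Q (!i) (!j) (u.map fl) := by
  obtain ⟨ru, hu1, hu2⟩ := hu
  refine ⟨red_fl ru, ?_, ?_⟩
  · cases u with
    | nil => simp at hu1
    | cons a u => simpa [TKAux.fl] using hu1
  · rcases List.eq_nil_or_concat u with rfl | ⟨v', b, rfl⟩
    · simp at hu2
    · simpa [TKAux.fl] using hu2

theorem Q.pow {i : Bool} {u : List (Lt A)} (hu : Q i (!i) u) (n : ℕ) :
    ∃ v, Q i (!i) v ∧ pr v = pr u ^ (n + 1) := by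
  induction n with
  | zero => exact ⟨u, hu, by simp⟩
  | succ n ih =>
    obtain ⟨v, hv, hv2⟩ := ih
    exact ⟨v ++ u, hv.append hu (by simp), by rw [pr_append, hv2, ← pow_succ]⟩

theorem Q.not_central {i : Bool} {u : List (Lt A)} (hu : Q i (!i) u) :
    pr u ∉ Subgroup.center (FP A) := by
  intro hc
  obtain ⟨ru, hu1, hu2⟩ := hu
  cases u with
  | nil => simp at hu1
  | cons a t =>
    simp only [List.head?_cons, Option.map_some, Option.some.injEq] at hu1
    have hcomm := (Subgroup.mem_center_iff.1 hc) (ofL a)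
    rw [pr_cons, mul_assoc] at hcomm
    have h1 := mul_left_cancel hcomm
    have hra : Red [a] := ⟨by simpa using ru.1 a (by simp), by simp⟩
    have hrt : Red t := ⟨fun s hs => ru.1 s (by simp [hs]), ru.2.tail⟩
    rcases List.eq_nil_or_concat t with rfl | ⟨v', b, rfl⟩
    · simp [hu1] at hu2
    · rw [List.concat_eq_append] at *
      rw [← List.cons_append] at hu2
      simp only [List.getLast?_append, List.getLast?_singleton, Option.some_or, Option.map_some,
        Option.some.injEq] at hu2
      have hr2 : Red ((v' ++ [b]) ++ [a]) := by
        apply red_append hrt hra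
        intro x hx y hy
        simp at hx hy
        subst hx; subst hy
        rw [hu1, hu2]; simp
      have h2 : pr (a :: (v' ++ [b])) = pr ((v' ++ [b]) ++ [a]) := by
        rw [pr_cons, h1, pr_append (v' ++ [b]) [a]]
        simp [pr]
      have h3 := congrArg List.getLast? (pr_inj ru hr2 h2)
      rw [← List.cons_append] at h3
      simp only [List.getLast?_append, List.getLast?_singleton, Option.some_or,
        Option.some.injEq] at h3
      rw [h3, hu1] at hu2
      simp at hu2

theorem main_aux (N : ℕ) : ∀ l : List (Lt A), l.length ≤ N → Red l →
    (∃ n : ℕ, (pr l * sw (pr l)) ^ (n + 1) ∈ Subgroup.center (FP A)) →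
    ∀ w, pr l * sw w = w * pr l → w = 1 := by
  induction N with
  | zero =>
    intro l hl _ _ w hw
    have : l = [] := List.length_eq_zero_iff.1 (by omega)
    subst this
    rw [pr_nil, one_mul, mul_one] at hw
    exact sw_fix hw
  | succ N ih =>
    rintro l hl hr ⟨n, hn⟩ w hw
    cases l with
    | nil =>
      rw [pr_nil, one_mul, mul_one] at hw
      exact sw_fix hw
    | cons a t =>
      by_cases hQ : Q a.1 a.1 (a :: t)
      · exfalso
        have h1 := hQ.append hQ.fl (by simp)
        obtain ⟨v, hv, hv2⟩ := h1.pow n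
        apply hv.not_central
        rw [hv2, pr_append, ← sw_pr]
        exact hn
      · rcases List.eq_nil_or_concat t with rfl | ⟨m, b, rfl⟩
        · exfalso; apply hQ
          exact ⟨hr, by simp, by simp⟩
        · rw [List.concat_eq_append] at *
          have hba : b.1 = !a.1 := by
            by_contra hne
            apply hQ
            refine ⟨hr, by simp, ?_⟩
            rw [← List.cons_append]
            simp only [List.getLast?_append, List.getLast?_singleton, Option.some_or,
              Option.map_some, Option.some.injEq]
            cases h1 : b.1 <;> cases h2 : a.1 <;> simp_all
          have hrt : Red (m ++ [b]) := ⟨fun s hs => hr.1 s (by simp [hs]), hr.2.tail⟩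
          have hrm : Red m := ⟨fun s hs => hrt.1 s (by simp [hs]), (List.isChain_append.1 hrt.2).1⟩
          have hmb := (List.isChain_append.1 hrt.2).2.2
          -- shorter representative
          obtain ⟨l', hl', hr', hp'⟩ : ∃ l' : List (Lt A), l'.length ≤ N ∧ Red l' ∧
              pr l' = pr m * (ofL b * ofL (fl a)) := by
            have hb : ofL b * ofL (fl a) = ofL ⟨b.1, b.2 * a.2⟩ := by
              rcases a with ⟨i, a⟩
              rcases b with ⟨j, b⟩
              simp only at hba
              subst hba
              simp only [ofL, fl, map_mul]
            simp only [List.length_cons, List.length_append, List.length_nil] at hl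
            by_cases h1 : b.2 * a.2 = 1
            · refine ⟨m, by omega, hrm, ?_⟩
              rw [hb, h1]
              simp [ofL]
            · refine ⟨m ++ [⟨b.1, b.2 * a.2⟩], ?_, ?_, ?_⟩
              · simp only [List.length_append, List.length_cons, List.length_nil]; omega
              · apply red_append hrm
                · exact ⟨by simpa using h1, by simp⟩
                · intro x hx y hy
                  simp at hy
                  subst hy
                  exact hmb x hx b (by simp)
              · rw [pr_append, hb]; simp [pr]
          set g := pr (a :: (m ++ [b])) with hg
          have hg2 : pr l' = (ofL a)⁻¹ * g * sw (ofL a) := by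
            rw [hp', hg, pr_cons, pr_append, sw_ofL]
            simp [pr, mul_assoc]
          have key : (ofL a)⁻¹ * w * ofL a = 1 := by
            apply ih l' hl' hr'
            · refine ⟨n, ?_⟩
              have e : pr l' * sw (pr l') = (ofL a)⁻¹ * (g * sw g) * ((ofL a)⁻¹)⁻¹ := by
                rw [hg2]
                simp only [map_mul, map_inv, sw_sw]
                group
              rw [e, conj_pow]
              exact (inferInstance : (Subgroup.center (FP A)).Normal).conj_mem _ hn _
            · rw [hg2]
              simp only [map_mul, map_inv]
              calc _ = (ofL a)⁻¹ * (g * sw w) * sw (ofL a) := by group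
                _ = _ := by rw [hw]; group
          calc w = ofL a * ((ofL a)⁻¹ * w * ofL a) * (ofL a)⁻¹ := by group
            _ = 1 := by rw [key]; group

theorem main_fp (g w : FP A)
    (h : ∃ n : ℕ, (g * sw g) ^ (n + 1) ∈ Subgroup.center (FP A))
    (hw : g * sw w = w * g) : w = 1 := by
  obtain ⟨l, hl, rfl⟩ := exists_red g
  exact main_aux _ l le_rfl hl h w hw

end

abbrev Zp (p : ℕ) : Type := Multiplicative (ZMod p)

theorem rel (p : ℕ) : TKx p p ^ p = TKy p p ^ p := by
  have h := PresentedGroup.one_of_mem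
    (rels := ({FreeGroup.of true ^ p * (FreeGroup.of false ^ p)⁻¹} : Set (FreeGroup Bool)))
    (Set.mem_singleton _)
  rw [map_mul, map_inv, map_pow, map_pow, mul_inv_eq_one] at h
  exact h

theorem exists_hom {G : Type*} [Group G] (p : ℕ) (a b : G) (h : a ^ p = b ^ p) :
    ∃ f : TKG p p →* G, f (TKx p p) = a ∧ f (TKy p p) = b := by
  have hh : ∀ r ∈ ({FreeGroup.of true ^ p * (FreeGroup.of false ^ p)⁻¹} : Set (FreeGroup Bool)),
      FreeGroup.lift (fun i : Bool => if i then a else b) r = 1 := by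
    intro r hr
    rw [Set.mem_singleton_iff] at hr
    subst hr
    simp [h]
  refine ⟨PresentedGroup.toGroup hh, ?_, ?_⟩
  · exact (PresentedGroup.toGroup.of hh).trans (by simp)
  · exact (PresentedGroup.toGroup.of hh).trans (by simp)

theorem hom_ext {G : Type*} [Group G] {p : ℕ} {f k : TKG p p →* G}
    (hx : f (TKx p p) = k (TKx p p)) (hy : f (TKy p p) = k (TKy p p)) : f = k := by
  apply PresentedGroup.ext
  intro i
  cases i
  · exact hy
  · exact hx

theorem xp_central (p : ℕ) : TKx p p ^ p ∈ Subgroup.center (TKG p p) := by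
  have h : (MulAut.conj (TKx p p ^ p)).toMonoidHom = MonoidHom.id (TKG p p) := by
    apply hom_ext
    · simp only [MulEquiv.coe_toMonoidHom, MulAut.conj_apply, MonoidHom.id_apply]
      rw [mul_inv_eq_iff_eq_mul, ← pow_succ, ← pow_succ']
    · simp only [MulEquiv.coe_toMonoidHom, MulAut.conj_apply, MonoidHom.id_apply]
      rw [rel, mul_inv_eq_iff_eq_mul, ← pow_succ, ← pow_succ']
  rw [Subgroup.mem_center_iff]
  intro g
  have h2 := DFunLike.congr_fun h g
  simp only [MulEquiv.coe_toMonoidHom, MulAut.conj_apply, MonoidHom.id_apply] at h2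
  rw [mul_inv_eq_iff_eq_mul] at h2
  exact h2.symm

theorem exists_zp_hom {G : Type*} [Group G] (p : ℕ) (a : G) (h : a ^ p = 1) :
    ∃ f : Zp p →* G, f (Multiplicative.ofAdd 1) = a := by
  let f0 : ℤ →+ Additive G := zmultiplesHom _ (Additive.ofMul a)
  have h0 : f0 p = 0 := by
    simp only [f0, zmultiplesHom_apply, natCast_zsmul]
    rw [← ofMul_pow, h]; rfl
  refine ⟨AddMonoidHom.toMultiplicativeLeft (ZMod.lift p ⟨f0, h0⟩), ?_⟩
  have := ZMod.lift_coe p ⟨f0, h0⟩ 1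
  simp only [Int.cast_one, f0, zmultiplesHom_apply, one_zsmul] at this
  exact congrArg Additive.toMul this

theorem exists_pi (p : ℕ) : ∃ f : TKG p p →* FP (Zp p),
    Function.Surjective f ∧
    (∀ w, f w = 1 → w ∈ Subgroup.zpowers (TKx p p ^ p)) ∧
    f (TKx p p) = CoprodI.of (M := fun _ : Bool => Zp p) (i := true) (Multiplicative.ofAdd 1) ∧
    f (TKy p p) = CoprodI.of (M := fun _ : Bool => Zp p) (i := false) (Multiplicative.ofAdd 1) := by
  have hone : (Multiplicative.ofAdd (1 : ZMod p)) ^ p = 1 := by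
    rw [← ofAdd_nsmul]; simp
  have hof : ∀ i : Bool, (CoprodI.of (M := fun _ : Bool => Zp p) (i := i)
      (Multiplicative.ofAdd 1)) ^ p = 1 := by
    intro i
    have h := map_pow (CoprodI.of (M := fun _ : Bool => Zp p) (i := i))
      (Multiplicative.ofAdd (1 : ZMod p)) p
    rw [← h, hone]
    exact map_one _
  obtain ⟨f, hx, hy⟩ := exists_hom p
    (CoprodI.of (M := fun _ : Bool => Zp p) (i := true) (Multiplicative.ofAdd 1))
    (CoprodI.of (M := fun _ : Bool => Zp p) (i := false) (Multiplicative.ofAdd 1))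
    ((hof true).trans (hof false).symm)
  refine ⟨f, ?_, ?_, hx, hy⟩
  · have hz : ∀ a : Zp p, ∃ n : ℤ, (Multiplicative.ofAdd (1 : ZMod p)) ^ n = a := by
      intro a
      obtain ⟨n, hn⟩ := ZMod.intCast_surjective (Multiplicative.toAdd a)
      refine ⟨n, ?_⟩
      rw [← ofAdd_zsmul]
      simp [hn]
    intro w
    induction w using CoprodI.induction_on with
    | one => exact ⟨1, map_one f⟩
    | of i a =>
      obtain ⟨n, rfl⟩ := hz a
      cases i
      · exact ⟨TKy p p ^ n, by rw [map_zpow, map_zpow, hy]⟩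
      · exact ⟨TKx p p ^ n, by rw [map_zpow, map_zpow, hx]⟩
    | mul u v hu hv =>
      obtain ⟨u, rfl⟩ := hu
      obtain ⟨v, rfl⟩ := hv
      exact ⟨u * v, map_mul f u v⟩
  · intro w hw
    let N := Subgroup.zpowers (TKx p p ^ p)
    have hN : N.Normal := by
      constructor
      intro n hn g
      have hc : n ∈ Subgroup.center (TKG p p) :=
        (Subgroup.zpowers_le.2 (xp_central p)) hn
      rw [Subgroup.mem_center_iff.1 hc g, mul_inv_cancel_right]
      exact hn
    have hqx : (QuotientGroup.mk' N (TKx p p)) ^ p = 1 := by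
      rw [← map_pow]
      exact (QuotientGroup.eq_one_iff _).2 (Subgroup.mem_zpowers _)
    have hqy : (QuotientGroup.mk' N (TKy p p)) ^ p = 1 := by
      rw [← map_pow, ← rel, map_pow, hqx]
    obtain ⟨fx, hfx⟩ := exists_zp_hom p _ hqx
    obtain ⟨fy, hfy⟩ := exists_zp_hom p _ hqy
    let k : FP (Zp p) →* (TKG p p ⧸ N) :=
      CoprodI.lift (fun i : Bool => if i then fx else fy)
    have hk : k.comp f = QuotientGroup.mk' N := by
      apply hom_ext
      · rw [MonoidHom.comp_apply, hx]
        simp only [k, CoprodI.lift_of]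
        exact hfx
      · rw [MonoidHom.comp_apply, hy]
        simp only [k, CoprodI.lift_of]
        exact hfy
    have h2 := DFunLike.congr_fun hk w
    rw [MonoidHom.comp_apply, hw, map_one] at h2
    exact (QuotientGroup.eq_one_iff w).1 h2.symm

theorem xp_inf (p : ℕ) (hp : 2 ≤ p) :
    Function.Injective (zpowersHom (TKG p p) (TKx p p ^ p)) := by
  obtain ⟨f, hx, -⟩ := exists_hom p (Multiplicative.ofAdd (1 : ℤ)) (Multiplicative.ofAdd (1 : ℤ)) rfl
  rw [injective_iff_map_eq_one]
  intro n hn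
  rw [zpowersHom_apply] at hn
  have h := congrArg f hn
  rw [map_zpow, map_pow, hx, map_one f] at h
  have h2 := congrArg Multiplicative.toAdd h
  simp only [toAdd_zpow, toAdd_pow, toAdd_ofAdd, toAdd_one, smul_eq_mul, nsmul_eq_mul,
    mul_one, mul_eq_zero] at h2
  rcases h2 with h2 | h2
  · exact Multiplicative.toAdd.injective h2
  · omega

end TKAux

theorem TKG_fix_sigma_g_finite_order (p : ℕ) (hp : 2 ≤ p)
    (σ : MulAut (TKG p p))
    (hσx : σ (TKx p p) = TKy p p) (hσy : σ (TKy p p) = TKx p p)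
    (g : TKG p p) (hfin : IsOfFinOrder (MulAut.conj g * σ)) :
    fixSubgroup (MulAut.conj g * σ) = Subgroup.zpowers (TKx p p ^ p) ∧
    Nonempty (↥(fixSubgroup (MulAut.conj g * σ)) ≃* Multiplicative ℤ) := by
  have hmain : fixSubgroup (MulAut.conj g * σ) = Subgroup.zpowers (TKx p p ^ p) := by
    apply le_antisymm
    · intro w hw
      have hw' : g * σ w * g⁻¹ = w := hw
      obtain ⟨f, hsurj, hker, hx, hy⟩ := TKAux.exists_pi p
      have hfs0 : f.comp σ.toMonoidHom = TKAux.sw.comp f := by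
        apply TKAux.hom_ext
        · simp only [MonoidHom.comp_apply, MulEquiv.coe_toMonoidHom]
          rw [hσx, hx, hy, TKAux.sw_of]
        · simp only [MonoidHom.comp_apply, MulEquiv.coe_toMonoidHom]
          rw [hσy, hx, hy, TKAux.sw_of]
      have hfs : ∀ u, f (σ u) = TKAux.sw (f u) := fun u => DFunLike.congr_fun hfs0 u
      have hss0 : σ.toMonoidHom.comp σ.toMonoidHom = MonoidHom.id _ := by
        apply TKAux.hom_ext
        · simp [hσx, hσy]
        · simp [hσx, hσy]
      have hss : ∀ u, σ (σ u) = u := fun u => DFunLike.congr_fun hss0 u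
      apply hker
      apply TKAux.main_fp (f g) (f w)
      · obtain ⟨n, hn, hpow⟩ := isOfFinOrder_iff_pow_eq_one.1 hfin
        obtain ⟨n, rfl⟩ : ∃ m, n = m + 1 := ⟨n - 1, by omega⟩
        refine ⟨n, ?_⟩
        have hsq : (MulAut.conj g * σ) ^ 2 = MulAut.conj (g * σ g) := by
          ext u
          simp [pow_two, hss, mul_assoc]
        have h3 : MulAut.conj ((g * σ g) ^ (n + 1)) = 1 := by
          rw [map_pow, ← hsq, ← pow_mul, mul_comm, pow_mul, hpow, one_pow]
        rw [← hfs, ← map_mul, ← map_pow, Subgroup.mem_center_iff]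
        intro v
        obtain ⟨v, rfl⟩ := hsurj v
        have h4 := DFunLike.congr_fun h3 v
        rw [MulAut.conj_apply, MulAut.one_apply, mul_inv_eq_iff_eq_mul] at h4
        rw [← map_mul, ← map_mul, h4]
      · rw [← hfs, ← map_mul, ← map_mul]
        rw [mul_inv_eq_iff_eq_mul] at hw'
        rw [hw']
    · rw [Subgroup.zpowers_le]
      change g * σ (TKx p p ^ p) * g⁻¹ = TKx p p ^ p
      rw [map_pow, hσx, ← TKAux.rel, Subgroup.mem_center_iff.1 (TKAux.xp_central p) g,
        mul_inv_cancel_right]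
  refine ⟨hmain, ?_⟩
  rw [hmain]
  have e := (MonoidHom.ofInjective (TKAux.xp_inf p hp)).symm
  have hr : (zpowersHom (TKG p p) (TKx p p ^ p)).range = Subgroup.zpowers (TKx p p ^ p) := by
    ext u
    rw [MonoidHom.mem_range, Subgroup.mem_zpowers_iff]
    rfl
  exact ⟨(MulEquiv.subgroupCongr hr.symm).trans e⟩
end

section
/- Let p, q ≥ 2 be integers and G_{p,q} = ⟨x, y | x^p = y^q⟩. For every integer k ≠ 0, the element x^k is not conjugate to x^{-k} in G_{p,q}, and y^k is not conjugate to y^{-k} in G_{p,q}. -/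
/-- The homomorphism to the integers sending `x` to `q` and `y` to `p`. -/
theorem TKG_exists_hom (p q : ℕ) : ∃ f : TKG p q →* Multiplicative ℤ,
    f (TKx p q) = Multiplicative.ofAdd (q : ℤ) ∧ f (TKy p q) = Multiplicative.ofAdd (p : ℤ) := by
  have h : ∀ r ∈ ({FreeGroup.of true ^ p * (FreeGroup.of false ^ q)⁻¹} : Set (FreeGroup Bool)),
      FreeGroup.lift (fun b : Bool => Multiplicative.ofAdd (if b then (q : ℤ) else (p : ℤ))) r
        = 1 := by
    intro r hr
    rw [Set.mem_singleton_iff] at hr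
    subst hr
    simp only [map_mul, map_inv, map_pow, FreeGroup.lift_apply_of]
    rw [mul_inv_eq_one, ← ofAdd_nsmul, ← ofAdd_nsmul]
    simp [mul_comm]
  refine ⟨PresentedGroup.toGroup h, ?_, ?_⟩
  · exact (PresentedGroup.toGroup.of h).trans (by simp)
  · exact (PresentedGroup.toGroup.of h).trans (by simp)

theorem TKG_not_conj_aux {G : Type*} [Group G] (f : G →* Multiplicative ℤ) (g : G) (n : ℕ)
    (hn : 2 ≤ n) (hg : f g = Multiplicative.ofAdd (n : ℤ)) (k : ℤ) (hk : k ≠ 0) :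
    ¬ IsConj (g ^ k) (g ^ (-k)) := by
  intro h
  have h1 := isConj_iff_eq.mp (f.map_isConj h)
  rw [map_zpow, map_zpow, hg, ← ofAdd_zsmul, ← ofAdd_zsmul] at h1
  have h2 : k * (n : ℤ) = -k * n := by simpa using Multiplicative.ofAdd.injective h1
  have h3 : k * (n : ℤ) = 0 := by linarith
  rcases mul_eq_zero.mp h3 with h4 | h4
  · exact hk h4
  · omega

/-- In `G_{p,q}`, for every nonzero integer `k`, `x^k` is not conjugate to `x^(-k)`, and
`y^k` is not conjugate to `y^(-k)`. -/
theorem TKG_power_not_conj_inv_power (p q : ℕ) (hp : 2 ≤ p) (hq : 2 ≤ q) :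
    ∀ k : ℤ, k ≠ 0 →
      ¬ IsConj (TKx p q ^ k) (TKx p q ^ (-k)) ∧
      ¬ IsConj (TKy p q ^ k) (TKy p q ^ (-k)) := by
  intro k hk
  obtain ⟨f, hx, hy⟩ := TKG_exists_hom p q
  exact ⟨TKG_not_conj_aux f _ q hq hx k hk, TKG_not_conj_aux f _ p hp hy k hk⟩
end
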